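/- arXiv:2207.00652 — 2 statements merged into one kernel-verified Lean document; each statement's English description precedes it below -/
import Mathlib

section
/- For every ε > 0 there is a constant C_ε such that for every integer N ≥ 1, the exponential sum f_{2,N}(x) = ∑_{a=1}^N e^{2πi a² x} satisfies ∫_0^1 |f_{2,N}(x)|^4 dx ≤ C_ε N^{2+ε}. -/
open MeasureTheory

/-- **Divisor bound**: the number of divisors of `n` is `O(n ^ δ)` for every `δ > 0`. -/
theorem Nat.exists_card_divisors_le_rpow (δ : ℝ) (hδ : 0 < δ) :
    ∃ C : ℝ, ∀ n : ℕ, n ≠ 0 → (n.divisors.card : ℝ) ≤ C * (n : ℝ) ^ δ := by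
  obtain ⟨M, hM⟩ := exists_nat_gt ((2 : ℝ) ^ (1 / δ))
  have hδ2 : 0 < δ * Real.log 2 := mul_pos hδ (Real.log_pos one_lt_two)
  set K : ℝ := 1 + 1 / (δ * Real.log 2) with hK
  have hK1 : 1 ≤ K := by rw [hK]; linarith [one_div_pos.2 hδ2]
  have small (p v : ℕ) (hp : 2 ≤ p) : ((v : ℝ) + 1) ≤ K * ((p : ℝ) ^ δ) ^ v := by
    have h1 : 1 + v * (δ * Real.log 2) ≤ ((p : ℝ) ^ δ) ^ v := by
      calc 1 + v * (δ * Real.log 2) ≤ Real.exp (v * (δ * Real.log 2)) := by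
            linarith [Real.add_one_le_exp (v * (δ * Real.log 2))]
        _ = ((2 : ℝ) ^ δ) ^ v := by
            rw [Real.rpow_def_of_pos two_pos, ← Real.exp_nat_mul, mul_comm δ]
        _ ≤ _ := by
            gcongr
            exact_mod_cast hp
    calc (v : ℝ) + 1 ≤ K * (1 + v * (δ * Real.log 2)) := by
          have : K * (1 + v * (δ * Real.log 2))
              = v + 1 + (v * (δ * Real.log 2) + 1 / (δ * Real.log 2)) := by
            rw [hK]; field_simp; ring
          rw [this]
          have : 0 ≤ v * (δ * Real.log 2) + 1 / (δ * Real.log 2) := by positivity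
          linarith
      _ ≤ _ := by gcongr
  have large (p v : ℕ) (hp : M ≤ p) : ((v : ℝ) + 1) ≤ ((p : ℝ) ^ δ) ^ v := by
    have h2 : (2 : ℝ) ≤ (p : ℝ) ^ δ := by
      calc (2 : ℝ) = ((2 : ℝ) ^ (1 / δ)) ^ δ := by
            rw [← Real.rpow_mul two_pos.le, one_div_mul_cancel hδ.ne', Real.rpow_one]
        _ ≤ _ := by
            gcongr
            exact hM.le.trans (by exact_mod_cast hp)
    calc (v : ℝ) + 1 ≤ (2 : ℝ) ^ v := by exact_mod_cast Nat.lt_two_pow_self (n := v)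
      _ ≤ _ := by gcongr
  refine ⟨K ^ M, fun n hn => ?_⟩
  have hfac : (n : ℝ) ^ δ = ∏ p ∈ n.primeFactors, ((p : ℝ) ^ δ) ^ n.factorization p := by
    conv_lhs => rw [← Nat.prod_factorization_pow_eq_self hn]
    rw [Finsupp.prod, Nat.support_factorization, Nat.cast_prod,
      ← Real.finsetProd_rpow _ _ (fun _ _ => by positivity)]
    refine Finset.prod_congr rfl fun p _ => ?_
    rw [Nat.cast_pow, ← Real.rpow_natCast, ← Real.rpow_natCast, ← Real.rpow_mul (by positivity),
      ← Real.rpow_mul (by positivity), mul_comm]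
  rw [Nat.card_divisors hn, hfac, Nat.cast_prod]
  calc ∏ p ∈ n.primeFactors, ((n.factorization p + 1 : ℕ) : ℝ)
      ≤ ∏ p ∈ n.primeFactors,
          ((if p < M then K else 1) * ((p : ℝ) ^ δ) ^ n.factorization p) := by
        refine Finset.prod_le_prod (fun _ _ => by positivity) fun p hp => ?_
        push_cast
        split_ifs with h
        · exact small p _ (Nat.prime_of_mem_primeFactors hp).two_le
        · simpa using large p _ (not_lt.1 h)
    _ = K ^ (n.primeFactors.filter (· < M)).card *
          ∏ p ∈ n.primeFactors, ((p : ℝ) ^ δ) ^ n.factorization p := by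
        rw [Finset.prod_mul_distrib, Finset.prod_ite]
        simp
    _ ≤ _ := by
        gcongr
        calc _ ≤ (Finset.range M).card := Finset.card_le_card fun p hp => by
              simpa using (Finset.mem_filter.1 hp).2
          _ = M := Finset.card_range M

/-- Orthogonality of the characters `x ↦ e^{2πikx}` on the unit interval. -/
theorem integral_exp_two_pi_I_int_mul (k : ℤ) :
    ∫ x in (0 : ℝ)..1, Complex.exp (2 * Real.pi * Complex.I * k * x) = if k = 0 then 1 else 0 := by
  split_ifs with hk
  · simp [hk]
  · rw [integral_exp_mul_complex (by simp [hk, Real.pi_ne_zero])]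
    have : Complex.exp (2 * Real.pi * Complex.I * k) = 1 := by
      rw [mul_comm]; exact Complex.exp_int_mul_two_pi_mul_I k
    simp [this]

/-- The mean square of an exponential sum with integer frequencies counts coincidences. -/
theorem integral_norm_sq_sum_exp {ι : Type*} (s : Finset ι) (φ : ι → ℤ) :
    ∫ x in (0 : ℝ)..1, ‖∑ i ∈ s, Complex.exp (2 * Real.pi * Complex.I * φ i * x)‖ ^ 2
      = (((s ×ˢ s).filter fun p => φ p.1 = φ p.2).card : ℝ) := by
  have key (x : ℝ) :
      ((‖∑ i ∈ s, Complex.exp (2 * Real.pi * Complex.I * φ i * x)‖ ^ 2 : ℝ) : ℂ)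
        = ∑ p ∈ s ×ˢ s,
            Complex.exp (2 * Real.pi * Complex.I * ((φ p.1 - φ p.2 : ℤ) : ℂ) * x) := by
    rw [Complex.ofReal_pow, ← Complex.mul_conj', map_sum, Finset.sum_mul_sum,
      ← Finset.sum_product']
    refine Finset.sum_congr rfl fun p _ => ?_
    rw [← Complex.exp_conj, ← Complex.exp_add]
    congr 1
    simp [Complex.conj_ofNat]
    ring
  apply Complex.ofReal_injective
  rw [← intervalIntegral.integral_ofReal]
  simp_rw [key]
  rw [intervalIntegral.integral_finsetSum
    fun p _ => Continuous.intervalIntegrable (by fun_prop) _ _]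
  simp_rw [integral_exp_two_pi_I_int_mul, sub_eq_zero]
  simp

/-- The additive energy of the first `N` squares, in terms of a bound `D` for the number of
divisors of positive integers up to `N ^ 2`. -/
theorem card_sq_add_sq_eq_sq_add_sq_le (N D : ℕ)
    (hD : ∀ m : ℕ, m ≠ 0 → m ≤ N ^ 2 → m.divisors.card ≤ D) :
    (((Finset.Icc 1 N ×ˢ Finset.Icc 1 N) ×ˢ (Finset.Icc 1 N ×ˢ Finset.Icc 1 N)).filter
      fun p => ((p.1.1 : ℤ) ^ 2 + (p.1.2 : ℤ) ^ 2) = (p.2.1 : ℤ) ^ 2 + (p.2.2 : ℤ) ^ 2).card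
      ≤ N ^ 2 + D * N ^ 2 := by
  set S := ((Finset.Icc 1 N ×ˢ Finset.Icc 1 N) ×ˢ (Finset.Icc 1 N ×ˢ Finset.Icc 1 N)).filter
      fun p => ((p.1.1 : ℤ) ^ 2 + (p.1.2 : ℤ) ^ 2) = (p.2.1 : ℤ) ^ 2 + (p.2.2 : ℤ) ^ 2 with hS
  have memS {a b c d : ℕ} : ((a, b), (c, d)) ∈ S ↔
      (((1 ≤ a ∧ a ≤ N) ∧ (1 ≤ b ∧ b ≤ N)) ∧ ((1 ≤ c ∧ c ≤ N) ∧ (1 ≤ d ∧ d ≤ N))) ∧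
        (a : ℤ) ^ 2 + (b : ℤ) ^ 2 = (c : ℤ) ^ 2 + (d : ℤ) ^ 2 := by
    simp [hS]
  have hcard : (Finset.Icc 1 N ×ˢ Finset.Icc 1 N).card = N ^ 2 := by simp [sq]
  rw [← Finset.card_filter_add_card_filter_not (s := S) (fun p => p.1.1 = p.2.1)]
  refine Nat.add_le_add ?_ ?_
  · rw [← hcard]
    refine Finset.card_le_card_of_injOn (fun p => p.1) ?_ ?_
    · rintro ⟨⟨a, b⟩, c, d⟩ h
      obtain ⟨h, -⟩ := Finset.mem_filter.1 h
      have := (memS.1 h).1.1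
      exact Finset.mem_product.2 ⟨Finset.mem_Icc.2 this.1, Finset.mem_Icc.2 this.2⟩
    · have diag {a b c d : ℕ} (h : ((a, b), (c, d)) ∈ S.filter fun p => p.1.1 = p.2.1) :
          c = a ∧ d = b := by
        obtain ⟨h, hac⟩ := Finset.mem_filter.1 h
        obtain rfl : a = c := hac
        refine ⟨rfl, ?_⟩
        have := add_left_cancel (memS.1 h).2
        exact_mod_cast ((pow_left_inj₀ (by positivity) (by positivity) two_ne_zero).1 this).symm
      rintro ⟨⟨a, b⟩, c, d⟩ h ⟨⟨a', b'⟩, c', d'⟩ h' heq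
      obtain ⟨rfl, rfl⟩ := diag h
      obtain ⟨rfl, rfl⟩ := diag h'
      obtain ⟨rfl, rfl⟩ := Prod.mk.inj heq
      rfl
  · rw [← hcard]
    refine Finset.card_le_mul_card_image_of_maps_to (f := fun p => (p.1.1, p.2.1)) ?_ D ?_
    · rintro ⟨⟨a, b⟩, c, d⟩ h
      obtain ⟨h, -⟩ := Finset.mem_filter.1 h
      have := (memS.1 h).1
      exact Finset.mem_product.2 ⟨Finset.mem_Icc.2 this.1.1, Finset.mem_Icc.2 this.2.1⟩
    · rintro ⟨a, c⟩ hac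
      simp only [Finset.mem_product, Finset.mem_Icc] at hac
      have fiber {a' b c' d : ℕ} (h : ((a', b), (c', d)) ∈
          (S.filter fun p => ¬ p.1.1 = p.2.1).filter fun p => (p.1.1, p.2.1) = (a, c)) :
          a' = a ∧ c' = c ∧ a ≠ c ∧ 1 ≤ b ∧
            ((d + b : ℕ) : ℤ) * ((d : ℤ) - b) = (a : ℤ) ^ 2 - (c : ℤ) ^ 2 := by
        simp only [Finset.mem_filter, memS, Prod.mk.injEq] at h
        obtain ⟨⟨h, hne⟩, rfl, rfl⟩ := h
        refine ⟨rfl, rfl, hne, h.1.1.2.1, ?_⟩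
        push_cast
        linear_combination -h.2
      by_cases hne : a = c
      · rw [Finset.card_eq_zero.2]
        · exact Nat.zero_le _
        · refine Finset.eq_empty_of_forall_notMem ?_
          rintro ⟨⟨a', b⟩, c', d⟩ h
          exact (fiber h).2.2.1 hne
      have hne0 : (a : ℤ) ^ 2 - (c : ℤ) ^ 2 ≠ 0 := by
        rw [sub_ne_zero]
        intro h
        exact hne (by exact_mod_cast (pow_left_inj₀ (by positivity) (by positivity)
          two_ne_zero).1 h)
      refine le_trans ?_ (hD ((a : ℤ) ^ 2 - (c : ℤ) ^ 2).natAbs (Int.natAbs_ne_zero.2 hne0) ?_)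
      · refine Finset.card_le_card_of_injOn (fun p => p.2.2 + p.1.2) ?_ ?_
        · rintro ⟨⟨a', b⟩, c', d⟩ h
          obtain ⟨-, -, -, -, h⟩ := fiber h
          refine Nat.mem_divisors.2 ⟨?_, Int.natAbs_ne_zero.2 hne0⟩
          exact Int.natCast_dvd.1 ⟨_, h.symm⟩
        · rintro ⟨⟨a₁, b₁⟩, c₁, d₁⟩ h₁ ⟨⟨a₂, b₂⟩, c₂, d₂⟩ h₂ heq
          obtain ⟨rfl, rfl, -, hb, h₁⟩ := fiber h₁
          obtain ⟨rfl, rfl, -, -, h₂⟩ := fiber h₂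
          have heq : d₁ + b₁ = d₂ + b₂ := heq
          rw [← h₂, heq] at h₁
          have := mul_left_cancel₀ (by omega) h₁
          obtain ⟨rfl, rfl⟩ : b₁ = b₂ ∧ d₁ = d₂ := by omega
          rfl
      · zify
        have ha : (a : ℤ) ^ 2 ≤ (N : ℤ) ^ 2 := by gcongr; exact hac.1.2
        have hc : (c : ℤ) ^ 2 ≤ (N : ℤ) ^ 2 := by gcongr; exact hac.2.2
        rw [abs_le]
        constructor <;> nlinarith [sq_nonneg (a : ℤ), sq_nonneg (c : ℤ)]

/-- For every `ε > 0` there is a constant `C_ε` such that for every `N ≥ 1`, the exponential sum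
`f_{2,N}(x) = ∑_{a=1}^N e^{2πi a² x}` satisfies `∫_0^1 |f_{2,N}(x)|⁴ dx ≤ C_ε N^{2+ε}`. -/
theorem fourth_moment_quadratic_exp_sum (ε : ℝ) (hε : 0 < ε) :
    ∃ C : ℝ, ∀ N : ℕ, 1 ≤ N →
      (∫ x in Set.Icc (0 : ℝ) 1,
          ‖∑ a ∈ Finset.Icc 1 N, Complex.exp (2 * Real.pi * Complex.I * ((a : ℝ) ^ 2 * x : ℝ))‖ ^ 4)
        ≤ C * (N : ℝ) ^ ((2 : ℝ) + ε) := by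
  obtain ⟨C, hC⟩ := Nat.exists_card_divisors_le_rpow (ε / 2) (half_pos hε)
  have hC0 : 0 ≤ C := by simpa using (Nat.cast_nonneg _).trans (hC 1 one_ne_zero)
  refine ⟨1 + C, fun N hN => ?_⟩
  have hN1 : (1 : ℝ) ≤ N := by exact_mod_cast hN
  have hNε : ((N : ℝ) ^ 2) ^ (ε / 2) = (N : ℝ) ^ ε := by
    rw [← Real.rpow_natCast, ← Real.rpow_mul (by positivity)]
    congr 1
    push_cast
    ring
  have hcount := card_sq_add_sq_eq_sq_add_sq_le N ⌊C * (N : ℝ) ^ ε⌋₊ fun m hm hmN => by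
    refine Nat.le_floor ((hC m hm).trans ?_)
    rw [← hNε]
    gcongr
    exact_mod_cast hmN
  have hpow (x : ℝ) :
      ‖∑ a ∈ Finset.Icc 1 N, Complex.exp (2 * Real.pi * Complex.I * ((a : ℝ) ^ 2 * x : ℝ))‖ ^ 4
        = ‖∑ p ∈ Finset.Icc 1 N ×ˢ Finset.Icc 1 N,
            Complex.exp (2 * Real.pi * Complex.I * (((p.1 : ℤ) ^ 2 + (p.2 : ℤ) ^ 2 : ℤ) : ℂ) * x)‖
            ^ 2 := by
    rw [show 4 = 2 * 2 from rfl, pow_mul, ← norm_pow, sq (∑ a ∈ _, _), Finset.sum_mul_sum,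
      ← Finset.sum_product']
    congr 2
    refine Finset.sum_congr rfl fun p _ => ?_
    rw [← Complex.exp_add]
    congr 1
    push_cast
    ring
  rw [integral_Icc_eq_integral_Ioc, ← intervalIntegral.integral_of_le zero_le_one]
  simp_rw [hpow]
  rw [integral_norm_sq_sum_exp _ fun p : ℕ × ℕ => (p.1 : ℤ) ^ 2 + (p.2 : ℤ) ^ 2]
  calc _ ≤ ((N ^ 2 + ⌊C * (N : ℝ) ^ ε⌋₊ * N ^ 2 : ℕ) : ℝ) := by exact_mod_cast hcount
    _ = (1 + ⌊C * (N : ℝ) ^ ε⌋₊) * (N : ℝ) ^ 2 := by push_cast; ring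
    _ ≤ ((N : ℝ) ^ ε + C * (N : ℝ) ^ ε) * (N : ℝ) ^ 2 := by
        gcongr
        · exact Real.one_le_rpow hN1 hε.le
        · exact Nat.floor_le (by positivity)
    _ = (1 + C) * (N : ℝ) ^ ((2 : ℝ) + ε) := by
        rw [Real.rpow_add (by positivity), Real.rpow_two]
        ring
end

section
/- (Main conjecture in Vinogradov's mean value theorem, Bourgain–Demeter–Guth / Wooley.) Let k ≥ 1 and p ≥ 1 be real with k an integer, and define F_{k,N}(x_1,…,x_k) = ∑_{a=1}^N e^{2πi(a x_1 + a² x_2 + … + a^k x_k)}. For every ε > 0 there is a constant C(k,ε) such that for all integers N ≥ 1, ‖F_{k,N}‖_{L^p([0,1]^k)} ≤ C(k,ε) N^ε ( N^{1/2} + N^{1 − k(k+1)/(2p)} ). -/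
open MeasureTheory

namespace Vinogradov

section

open Polynomial
open scoped Classical

variable {ι Ω : Type}

/-- The additive character `x ↦ e^{2πix}` of the real line. -/
noncomputable def ee (x : ℝ) : ℂ := Complex.exp (2 * Real.pi * Complex.I * (x : ℂ))

lemma ee_add (x y : ℝ) : ee (x + y) = ee x * ee y := by
  simp only [ee, ← Complex.exp_add]
  push_cast
  ring_nf

lemma norm_ee (x : ℝ) : ‖ee x‖ = 1 := by
  have h : 2 * Real.pi * Complex.I * (x : ℂ) = ((2 * Real.pi * x : ℝ) : ℂ) * Complex.I := by
    push_cast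
    ring
  rw [ee, h, Complex.norm_exp_ofReal_mul_I]

lemma ee_eq_one_iff (x : ℝ) : ee x = 1 ↔ ∃ n : ℤ, x = n := by
  rw [ee, Complex.exp_eq_one_iff]
  have hpi : (2 * Real.pi * Complex.I : ℂ) ≠ 0 := Complex.two_pi_I_ne_zero
  constructor
  · rintro ⟨n, hn⟩
    refine ⟨n, ?_⟩
    have h : (x : ℂ) = n := by
      apply mul_left_cancel₀ hpi
      rw [hn]
      ring
    exact_mod_cast h
  · rintro ⟨n, rfl⟩
    refine ⟨n, ?_⟩
    push_cast
    ring

lemma ee_int (n : ℤ) : ee n = 1 := (ee_eq_one_iff _).2 ⟨n, rfl⟩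

lemma ee_add_int (x : ℝ) (n : ℤ) : ee (x + n) = ee x := by
  rw [ee_add, ee_int, mul_one]

/-- Phases with numerators congruent modulo the denominator agree. -/
lemma ee_div_congr {q : ℕ} (hq : q ≠ 0) {m n : ℤ} (h : (q : ℤ) ∣ m - n) :
    ee ((m : ℝ) / q) = ee ((n : ℝ) / q) := by
  obtain ⟨c, hc⟩ := h
  have hq' : (q : ℝ) ≠ 0 := by exact_mod_cast hq
  have hm : (m : ℝ) / q = (n : ℝ) / q + c := by
    have : (m : ℝ) = n + q * c := by
      have : m = n + q * c := by linarith
      exact_mod_cast this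
    rw [this]
    field_simp
  rw [hm, ee_add_int]

/-- The partition of `S` into classes of indices whose `ν`-values agree modulo `q`. -/
noncomputable def cls (ν : ι → ℤ) (q : ℕ) (S : Finset ι) : Finset (Finset ι) :=
  S.image fun i => S.filter fun j => (q : ℤ) ∣ ν j - ν i

section cls

variable {ν : ι → ℤ} {q : ℕ} {S J : Finset ι}

lemma subset_of_mem_cls (h : J ∈ cls ν q S) : J ⊆ S := by
  obtain ⟨i, -, rfl⟩ := Finset.mem_image.1 h
  exact Finset.filter_subset _ _

lemma nonempty_of_mem_cls (h : J ∈ cls ν q S) : J.Nonempty := by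
  obtain ⟨i, hi, rfl⟩ := Finset.mem_image.1 h
  exact ⟨i, by simp [hi]⟩

lemma dvd_of_mem_cls (h : J ∈ cls ν q S) {i j : ι} (hi : i ∈ J) (hj : j ∈ J) :
    (q : ℤ) ∣ ν i - ν j := by
  obtain ⟨a, -, rfl⟩ := Finset.mem_image.1 h
  have h1 := (Finset.mem_filter.1 hi).2
  have h2 := (Finset.mem_filter.1 hj).2
  have := dvd_sub h1 h2
  simpa using this

lemma eq_filter_of_mem_cls (h : J ∈ cls ν q S) {i : ι} (hi : i ∈ J) :
    J = S.filter fun j => (q : ℤ) ∣ ν j - ν i := by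
  obtain ⟨a, -, rfl⟩ := Finset.mem_image.1 h
  have h1 := (Finset.mem_filter.1 hi).2
  ext j
  simp only [Finset.mem_filter]
  refine and_congr_right fun _ => ?_
  have e1 : ν j - ν a = (ν j - ν i) + (ν i - ν a) := by ring
  rw [e1]
  exact (Int.dvd_add_left h1)

lemma filter_mem_cls {i : ι} (hi : i ∈ S) :
    (S.filter fun j => (q : ℤ) ∣ ν j - ν i) ∈ cls ν q S :=
  Finset.mem_image_of_mem _ hi

lemma cls_disjoint {J' : Finset ι} (h : J ∈ cls ν q S) (h' : J' ∈ cls ν q S) (hne : J ≠ J') :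
    Disjoint J J' := by
  rw [Finset.disjoint_left]
  intro i hi hi'
  exact hne ((eq_filter_of_mem_cls h hi).trans (eq_filter_of_mem_cls h' hi').symm)

lemma not_dvd_of_cls_ne {J' : Finset ι} (h : J ∈ cls ν q S) (h' : J' ∈ cls ν q S)
    (hne : J ≠ J') {i j : ι} (hi : i ∈ J) (hj : j ∈ J') : ¬ (q : ℤ) ∣ ν i - ν j := by
  intro hd
  have : i ∈ J' := by
    rw [eq_filter_of_mem_cls h' hj]
    exact Finset.mem_filter.2 ⟨subset_of_mem_cls h hi, hd⟩
  exact Finset.disjoint_left.1 (cls_disjoint h h' hne) hi this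

lemma biUnion_cls : (cls ν q S).biUnion id = S := by
  ext i
  simp only [Finset.mem_biUnion, id]
  constructor
  · rintro ⟨J, hJ, hi⟩
    exact subset_of_mem_cls hJ hi
  · intro hi
    exact ⟨_, filter_mem_cls hi, by simp [hi]⟩

lemma sum_cls {M : Type*} [AddCommMonoid M] (g : ι → M) :
    ∑ J ∈ cls ν q S, ∑ i ∈ J, g i = ∑ i ∈ S, g i := by
  conv_rhs => rw [← biUnion_cls (ν := ν) (q := q) (S := S)]
  rw [Finset.sum_biUnion]
  · rfl
  · intro J hJ J' hJ' hne
    exact cls_disjoint hJ hJ' hne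

lemma cls_refine {q' : ℕ} (hq : q ∣ q') :
    cls ν q' S = (cls ν q S).biUnion fun J => cls ν q' J := by
  have hq' : (q : ℤ) ∣ (q' : ℤ) := by exact_mod_cast hq
  have key : ∀ i ∈ S, (S.filter fun j => (q' : ℤ) ∣ ν j - ν i) =
      (S.filter fun j => (q : ℤ) ∣ ν j - ν i).filter fun j => (q' : ℤ) ∣ ν j - ν i := by
    intro i _
    rw [Finset.filter_filter]
    refine Finset.filter_congr fun j _ => ?_
    exact ⟨fun h => ⟨hq'.trans h, h⟩, fun h => h.2⟩
  ext K
  simp only [Finset.mem_biUnion]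
  constructor
  · intro hK
    obtain ⟨i, hi, rfl⟩ := Finset.mem_image.1 hK
    refine ⟨_, filter_mem_cls hi, ?_⟩
    rw [key i hi]
    exact filter_mem_cls (by simp [hi])
  · rintro ⟨J, hJ, hK⟩
    obtain ⟨i, hi, rfl⟩ := Finset.mem_image.1 hK
    rw [eq_filter_of_mem_cls hJ hi, ← key i (subset_of_mem_cls hJ hi)]
    exact filter_mem_cls (subset_of_mem_cls hJ hi)

lemma sum_cls_refine {q' : ℕ} (hq : q ∣ q') (F : Finset ι → ℝ) :
    ∑ J ∈ cls ν q S, ∑ K ∈ cls ν q' J, F K = ∑ K ∈ cls ν q' S, F K := by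
  rw [cls_refine hq, Finset.sum_biUnion]
  intro J hJ J' hJ' hne
  simp only [Function.onFun]
  rw [Finset.disjoint_left]
  intro K hK hK'
  obtain ⟨i, hi⟩ := nonempty_of_mem_cls hK
  exact Finset.disjoint_left.1 (cls_disjoint hJ hJ' hne) (subset_of_mem_cls hK hi)
    (subset_of_mem_cls hK' hi)

lemma card_cls_le (hq : 0 < q) : (cls ν q S).card ≤ q := by
  have hq' : (0 : ℤ) < q := by exact_mod_cast hq
  have : (cls ν q S).card ≤ (Finset.Ico (0 : ℤ) q).card := by
    have hex : ∀ J ∈ cls ν q S, ∃ z : ℤ, ∃ i ∈ J, ν i = z := fun J hJ =>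
      (nonempty_of_mem_cls hJ).elim fun i hi => ⟨ν i, i, hi, rfl⟩
    choose! g hg using hex
    refine Finset.card_le_card_of_injOn (fun J => g J % q) ?_ ?_
    · intro J hJ
      simp only [Finset.coe_Ico, Set.mem_Ico]
      exact ⟨Int.emod_nonneg _ hq'.ne', Int.emod_lt_of_pos _ hq'⟩
    · intro J hJ J' hJ' h
      by_contra hne
      obtain ⟨i, hi, hgi⟩ := hg J hJ
      obtain ⟨j, hj, hgj⟩ := hg J' hJ'
      refine not_dvd_of_cls_ne hJ hJ' hne hi hj ?_
      rw [hgi, hgj]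
      exact Int.ModEq.dvd (Int.ModEq.symm h)
  simpa using this

lemma cls_congr {ν' : ι → ℤ} {q' : ℕ}
    (h : ∀ i ∈ S, ∀ j ∈ S, ((q : ℤ) ∣ ν i - ν j ↔ (q' : ℤ) ∣ ν' i - ν' j)) :
    cls ν q S = cls ν' q' S := by
  refine Finset.image_congr fun i hi => ?_
  exact Finset.filter_congr fun j hj => h j hj i hi

lemma cls_of_forall_dvd (hS : S.Nonempty) (h : ∀ i ∈ S, ∀ j ∈ S, (q : ℤ) ∣ ν i - ν j) :
    cls ν q S = {S} := by
  ext J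
  simp only [Finset.mem_singleton]
  constructor
  · intro hJ
    obtain ⟨i, hi, rfl⟩ := Finset.mem_image.1 hJ
    exact Finset.filter_true_of_mem fun j hj => h j hj i hi
  · rintro rfl
    obtain ⟨i, hi⟩ := hS
    refine Finset.mem_image.2 ⟨i, hi, Finset.filter_true_of_mem fun j hj => h j hj i hi⟩

end cls

/-- The exponential sum with terms `u i`, `i ∈ S`. -/
noncomputable def fsum (u : ι → Ω → ℂ) (S : Finset ι) (ω : Ω) : ℂ := ∑ i ∈ S, u i ω

lemma fsum_cls (u : ι → Ω → ℂ) (ν : ι → ℤ) (q : ℕ) (S : Finset ι) (ω : Ω) :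
    ∑ J ∈ cls ν q S, fsum u J ω = fsum u S ω := sum_cls _

/-- A family `u i` of functions on a weighted finite space on which every integer polynomial `P`
of degree at most `k` acts by a weight-preserving permutation multiplying `u i` by
`e(P(ν i) / p ^ M)`. -/
structure PhaseSystem (p k M : ℕ) (w : Ω → ℝ) (u : ι → Ω → ℂ) (ν : ι → ℤ) (S : Finset ι) :
    Prop where
  nonneg : ∀ ω, 0 ≤ w ω
  shift : ∀ P : ℤ[X], P.natDegree ≤ k → ∃ T : Equiv.Perm Ω, (∀ ω, w (T ω) = w ω) ∧
    ∀ i ∈ S, ∀ ω, u i (T ω) = ee (((P.eval (ν i) : ℤ) : ℝ) / (p ^ M : ℕ)) * u i ω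

lemma PhaseSystem.mono {p k M : ℕ} {w : Ω → ℝ} {u : ι → Ω → ℂ} {ν : ι → ℤ} {S S' : Finset ι}
    (h : PhaseSystem p k M w u ν S) (hS : S' ⊆ S) : PhaseSystem p k M w u ν S' :=
  ⟨h.nonneg, fun P hP => (h.shift P hP).imp fun _ hT => ⟨hT.1, fun i hi => hT.2 i (hS hi)⟩⟩

/-- The critical exponent `k (k + 1)`. -/
noncomputable def crit (k : ℕ) : ℝ := k * (k + 1)

variable [Fintype Ω]

/-- The mixed moment of two exponential sums. -/
noncomputable def mixed (w : Ω → ℝ) (u : ι → Ω → ℂ) (x y : ℝ) (S₁ S₂ : Finset ι) : ℝ :=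
  ∑ ω, w ω * (‖fsum u S₁ ω‖ ^ x * ‖fsum u S₂ ω‖ ^ y)

/-- The moment of order `x` of an exponential sum. -/
noncomputable def moment (w : Ω → ℝ) (u : ι → Ω → ℂ) (x : ℝ) (S : Finset ι) : ℝ :=
  ∑ ω, w ω * ‖fsum u S ω‖ ^ x

/-- The sum of the squares of the critical norms of the pieces of `S` modulo `q`. -/
noncomputable def sqSum (k : ℕ) (w : Ω → ℝ) (u : ι → Ω → ℂ) (ν : ι → ℤ) (q : ℕ)
    (S : Finset ι) : ℝ :=
  ∑ J ∈ cls ν q S, moment w u (crit k) J ^ (1 / (crit k / 2))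

/-- `A` is an admissible decoupling constant, for the critical exponent and pieces modulo
`p ^ H`. -/
def Dec (p k H : ℕ) (A : ℝ) : Prop :=
  ∀ (Ω ι : Type) [Fintype Ω] (w : Ω → ℝ) (u : ι → Ω → ℂ) (ν : ι → ℤ) (S : Finset ι),
    PhaseSystem p k (k * H) w u ν S →
      moment w u (crit k) S ≤ A * sqSum k w u ν (p ^ H) S ^ (crit k / 2)

/-- `B` is an admissible bilinear decoupling constant, for exponents `x`, `y` and transversal
pieces contained in residue classes modulo `p ^ a` and `p ^ b`. -/
def Bil (p k : ℕ) (x y : ℝ) (a b H : ℕ) (B : ℝ) : Prop :=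
  ∀ (Ω ι : Type) [Fintype Ω] (w : Ω → ℝ) (u : ι → Ω → ℂ) (ν : ι → ℤ) (S₁ S₂ : Finset ι),
    PhaseSystem p k (k * H) w u ν (S₁ ∪ S₂) →
    (∀ i ∈ S₁, ∀ j ∈ S₁, ((p ^ a : ℕ) : ℤ) ∣ ν i - ν j) →
    (∀ i ∈ S₂, ∀ j ∈ S₂, ((p ^ b : ℕ) : ℤ) ∣ ν i - ν j) →
    (∀ i ∈ S₁, ∀ j ∈ S₂, ¬ (p : ℤ) ∣ ν i - ν j) →
      mixed w u x y S₁ S₂ ≤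
        B * (sqSum k w u ν (p ^ H) S₁ ^ (x / 2) * sqSum k w u ν (p ^ H) S₂ ^ (y / 2))

lemma crit_nonneg (k : ℕ) : 0 ≤ crit k := by
  unfold crit
  positivity

lemma crit_pos {k : ℕ} (hk : 1 ≤ k) : 0 < crit k := by
  have : (0 : ℝ) < k := by exact_mod_cast hk
  unfold crit
  positivity

section basic

variable {w : Ω → ℝ} {u : ι → Ω → ℂ} {ν : ι → ℤ} {S S₁ S₂ : Finset ι} {q k : ℕ} {x y : ℝ}

lemma moment_nonneg (hw : ∀ ω, 0 ≤ w ω) : 0 ≤ moment w u x S :=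
  Finset.sum_nonneg fun ω _ => mul_nonneg (hw ω) (by positivity)

lemma mixed_nonneg (hw : ∀ ω, 0 ≤ w ω) : 0 ≤ mixed w u x y S₁ S₂ :=
  Finset.sum_nonneg fun ω _ => mul_nonneg (hw ω) (by positivity)

lemma mixed_comm : mixed w u x y S₁ S₂ = mixed w u y x S₂ S₁ :=
  Finset.sum_congr rfl fun ω _ => by rw [mul_comm (‖fsum u S₁ ω‖ ^ x)]

lemma sqSum_nonneg (hw : ∀ ω, 0 ≤ w ω) : 0 ≤ sqSum k w u ν q S :=
  Finset.sum_nonneg fun _ _ => Real.rpow_nonneg (moment_nonneg hw) _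

lemma sum_sqSum {q' : ℕ} (hq : q ∣ q') :
    ∑ J ∈ cls ν q S, sqSum k w u ν q' J = sqSum k w u ν q' S := sum_cls_refine hq _

lemma sqSum_le_of_mem_cls (hw : ∀ ω, 0 ≤ w ω) {q' : ℕ} (hq : q ∣ q') {J : Finset ι}
    (hJ : J ∈ cls ν q S) : sqSum k w u ν q' J ≤ sqSum k w u ν q' S := by
  rw [← sum_sqSum (S := S) hq]
  exact Finset.single_le_sum (f := fun K => sqSum k w u ν q' K) (fun K _ => sqSum_nonneg hw) hJ

end basic

lemma Bil.symm {p k : ℕ} {x y : ℝ} {a b H : ℕ} {B : ℝ} (h : Bil p k x y a b H B) :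
    Bil p k y x b a H B := by
  intro Ω ι _ w u ν S₁ S₂ hs h1 h2 h3
  rw [mixed_comm, mul_comm (_ ^ _)]
  refine h Ω ι w u ν S₂ S₁ (by rwa [Finset.union_comm]) h2 h1 fun i hi j hj hd => ?_
  refine h3 j hj i hi ?_
  rw [← neg_sub]
  exact (dvd_neg).2 hd

lemma Dec.mono {p k H : ℕ} {A A' : ℝ} (h : Dec p k H A) (hA : A ≤ A') : Dec p k H A' := by
  intro Ω ι _ w u ν S hs
  refine (h Ω ι w u ν S hs).trans ?_
  exact mul_le_mul_of_nonneg_right hA (Real.rpow_nonneg (sqSum_nonneg hs.nonneg) _)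

lemma Bil.mono {p k : ℕ} {x y : ℝ} {a b H : ℕ} {B B' : ℝ} (h : Bil p k x y a b H B)
    (hB : B ≤ B') : Bil p k x y a b H B' := by
  intro Ω ι _ w u ν S₁ S₂ hs h1 h2 h3
  refine (h Ω ι w u ν S₁ S₂ hs h1 h2 h3).trans ?_
  exact mul_le_mul_of_nonneg_right hB (mul_nonneg (Real.rpow_nonneg (sqSum_nonneg hs.nonneg) _)
    (Real.rpow_nonneg (sqSum_nonneg hs.nonneg) _))

end

section

open Polynomial
open scoped Classical

variable {ι Ω : Type}

section inequalities

lemma holder_weighted (s : Finset Ω) {w F G : Ω → ℝ} (hw : ∀ ω, 0 ≤ w ω) (hF : ∀ ω, 0 ≤ F ω)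
    (hG : ∀ ω, 0 ≤ G ω) {θ : ℝ} (h0 : 0 < θ) (h1 : θ < 1) :
    ∑ ω ∈ s, w ω * (F ω ^ θ * G ω ^ (1 - θ)) ≤
      (∑ ω ∈ s, w ω * F ω) ^ θ * (∑ ω ∈ s, w ω * G ω) ^ (1 - θ) := by
  have h1' : 0 < 1 - θ := by linarith
  have hc : (1 / θ).HolderConjugate (1 / (1 - θ)) := by
    rw [Real.holderConjugate_iff]
    refine ⟨(one_lt_div h0).2 h1, ?_⟩
    simp
  have := Real.inner_le_Lp_mul_Lq_of_nonneg s (f := fun ω => (w ω * F ω) ^ θ)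
    (g := fun ω => (w ω * G ω) ^ (1 - θ)) hc
    (fun ω _ => Real.rpow_nonneg (mul_nonneg (hw ω) (hF ω)) _)
    (fun ω _ => Real.rpow_nonneg (mul_nonneg (hw ω) (hG ω)) _)
  simp only [one_div, inv_inv] at this
  refine le_trans (le_of_eq ?_) (this.trans (le_of_eq ?_))
  · refine Finset.sum_congr rfl fun ω _ => ?_
    rw [Real.mul_rpow (hw ω) (hF ω), Real.mul_rpow (hw ω) (hG ω)]
    have : w ω = w ω ^ θ * w ω ^ (1 - θ) := by
      rw [← Real.rpow_add_of_nonneg (hw ω) h0.le h1'.le]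
      simp
    nth_rewrite 1 [this]
    ring
  · congr 2
    · refine Finset.sum_congr rfl fun ω _ => ?_
      rw [Real.rpow_rpow_inv (mul_nonneg (hw ω) (hF ω)) h0.ne']
    · refine Finset.sum_congr rfl fun ω _ => ?_
      rw [Real.rpow_rpow_inv (mul_nonneg (hw ω) (hG ω)) h1'.ne']

lemma minkowski_weighted [Fintype Ω] {w : Ω → ℝ} (hw : ∀ ω, 0 ≤ w ω) {s : ℝ} (hs : 1 ≤ s)
    {τ : Type*} (t : Finset τ) (g : τ → Ω → ℝ) (hg : ∀ i ω, 0 ≤ g i ω) :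
    (∑ ω, w ω * (∑ i ∈ t, g i ω) ^ s) ^ (1 / s) ≤
      ∑ i ∈ t, (∑ ω, w ω * g i ω ^ s) ^ (1 / s) := by
  have hs0 : 0 < s := by linarith
  induction t using Finset.induction_on with
  | empty =>
    simp only [Finset.sum_empty, Real.zero_rpow hs0.ne', mul_zero, Finset.sum_const_zero]
    rw [Real.zero_rpow (by positivity)]
  | insert a t ha ih =>
    rw [Finset.sum_insert ha]
    refine le_trans ?_ (add_le_add_right ih _)
    have hwr : ∀ ω, 0 ≤ w ω ^ (1 / s) := fun ω => Real.rpow_nonneg (hw ω) _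
    have hsum : ∀ ω, 0 ≤ ∑ i ∈ t, g i ω := fun ω => Finset.sum_nonneg fun i _ => hg i ω
    have key : ∀ (h : Ω → ℝ), (∀ ω, 0 ≤ h ω) →
        ∀ ω, (w ω ^ (1 / s) * h ω) ^ s = w ω * h ω ^ s := by
      intro h hh ω
      rw [Real.mul_rpow (hwr ω) (hh ω), one_div, Real.rpow_inv_rpow (hw ω) hs0.ne']
    have := Real.Lp_add_le_of_nonneg Finset.univ (f := fun ω => w ω ^ (1 / s) * g a ω)
      (g := fun ω => w ω ^ (1 / s) * ∑ i ∈ t, g i ω) hs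
      (fun ω _ => mul_nonneg (hwr ω) (hg a ω)) (fun ω _ => mul_nonneg (hwr ω) (hsum ω))
    simp only [← mul_add] at this
    simp only [key (g a) (hg a), key _ hsum,
      key (fun ω => g a ω + ∑ i ∈ t, g i ω) (fun ω => add_nonneg (hg a ω) (hsum ω))] at this
    simpa only [Finset.sum_insert ha] using this

lemma sum_rpow_le {τ : Type*} (t : Finset τ) {N : τ → ℝ} (hN : ∀ i, 0 ≤ N i) {s : ℝ}
    (hs : 1 ≤ s) : ∑ i ∈ t, N i ^ s ≤ (∑ i ∈ t, N i) ^ s := by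
  have hs0 : 0 < s := by linarith
  induction t using Finset.induction_on with
  | empty => simp [Real.zero_rpow hs0.ne']
  | insert a t ha ih =>
    rw [Finset.sum_insert ha, Finset.sum_insert ha]
    refine (add_le_add_right ih _).trans ?_
    exact Real.add_rpow_le_rpow_add (hN a) (Finset.sum_nonneg fun i _ => hN i) hs

/-- A crude bound for a power of a sum with few terms. -/
lemma norm_sum_rpow_le {τ : Type*} (t : Finset τ) (z : τ → ℂ) {n x : ℝ} (hn : (t.card : ℝ) ≤ n)
    (hx : 0 < x) : ‖∑ i ∈ t, z i‖ ^ x ≤ n ^ x * ∑ i ∈ t, ‖z i‖ ^ x := by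
  have hn0 : 0 ≤ n := le_trans (Nat.cast_nonneg _) hn
  rcases t.eq_empty_or_nonempty with rfl | ht
  · simp [Real.zero_rpow hx.ne']
  · obtain ⟨a, ha, hmax⟩ := t.exists_max_image (fun i => ‖z i‖) ht
    have h1 : ‖∑ i ∈ t, z i‖ ≤ n * ‖z a‖ := by
      refine (norm_sum_le _ _).trans ((Finset.sum_le_card_nsmul _ _ _ hmax).trans ?_)
      rw [nsmul_eq_mul]
      exact mul_le_mul_of_nonneg_right hn (norm_nonneg _)
    calc ‖∑ i ∈ t, z i‖ ^ x ≤ (n * ‖z a‖) ^ x := Real.rpow_le_rpow (norm_nonneg _) h1 hx.le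
      _ = n ^ x * ‖z a‖ ^ x := Real.mul_rpow hn0 (norm_nonneg _)
      _ ≤ _ := by
        refine mul_le_mul_of_nonneg_left ?_ (by positivity)
        exact Finset.single_le_sum (f := fun i => ‖z i‖ ^ x) (fun i _ => by positivity) ha

end inequalities

/-- Interpolation of bilinear decoupling constants. -/
lemma Bil.interpolate {p k : ℕ} {x₁ y₁ x₂ y₂ x y : ℝ} {a b H : ℕ} {B₁ B₂ θ : ℝ}
    (h₁ : Bil p k x₁ y₁ a b H B₁) (h₂ : Bil p k x₂ y₂ a b H B₂) (h0 : 0 < θ) (h1 : θ < 1)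
    (hx₁ : 0 ≤ x₁) (hx₂ : 0 ≤ x₂) (hy₁ : 0 ≤ y₁) (hy₂ : 0 ≤ y₂) (hB₁ : 0 ≤ B₁) (hB₂ : 0 ≤ B₂)
    (hx : x = θ * x₁ + (1 - θ) * x₂) (hy : y = θ * y₁ + (1 - θ) * y₂) :
    Bil p k x y a b H (B₁ ^ θ * B₂ ^ (1 - θ)) := by
  intro Ω ι _ w u ν S₁ S₂ hs hS₁ hS₂ h3
  have h1' : 0 < 1 - θ := by linarith
  have split : ∀ {v : ℝ}, 0 ≤ v → ∀ {z₁ z₂ : ℝ}, 0 ≤ z₁ → 0 ≤ z₂ →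
      v ^ (θ * z₁ + (1 - θ) * z₂) = (v ^ z₁) ^ θ * (v ^ z₂) ^ (1 - θ) := by
    intro v hv z₁ z₂ hz₁ hz₂
    rw [Real.rpow_add_of_nonneg hv (by positivity) (by positivity), mul_comm θ,
      mul_comm (1 - θ), Real.rpow_mul hv, Real.rpow_mul hv]
  have e1 := h₁ Ω ι w u ν S₁ S₂ hs hS₁ hS₂ h3
  have e2 := h₂ Ω ι w u ν S₁ S₂ hs hS₁ hS₂ h3
  have hw := hs.nonneg
  have hV₁ := sqSum_nonneg (k := k) (u := u) (ν := ν) (q := p ^ H) (S := S₁) hw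
  have hV₂ := sqSum_nonneg (k := k) (u := u) (ν := ν) (q := p ^ H) (S := S₂) hw
  set V₁ := sqSum k w u ν (p ^ H) S₁
  set V₂ := sqSum k w u ν (p ^ H) S₂
  have hold := holder_weighted Finset.univ hw
    (F := fun ω => ‖fsum u S₁ ω‖ ^ x₁ * ‖fsum u S₂ ω‖ ^ y₁)
    (G := fun ω => ‖fsum u S₁ ω‖ ^ x₂ * ‖fsum u S₂ ω‖ ^ y₂)
    (fun ω => by positivity) (fun ω => by positivity) h0 h1
  have hmixed : mixed w u x y S₁ S₂ = ∑ ω, w ω *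
      ((‖fsum u S₁ ω‖ ^ x₁ * ‖fsum u S₂ ω‖ ^ y₁) ^ θ *
        (‖fsum u S₁ ω‖ ^ x₂ * ‖fsum u S₂ ω‖ ^ y₂) ^ (1 - θ)) := by
    refine Finset.sum_congr rfl fun ω _ => ?_
    rw [hx, hy, split (norm_nonneg _) hx₁ hx₂, split (norm_nonneg _) hy₁ hy₂,
      Real.mul_rpow (by positivity) (by positivity),
      Real.mul_rpow (by positivity) (by positivity)]
    ring
  rw [hmixed]
  refine hold.trans ?_
  calc mixed w u x₁ y₁ S₁ S₂ ^ θ * mixed w u x₂ y₂ S₁ S₂ ^ (1 - θ)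
      ≤ (B₁ * (V₁ ^ (x₁ / 2) * V₂ ^ (y₁ / 2))) ^ θ *
        (B₂ * (V₁ ^ (x₂ / 2) * V₂ ^ (y₂ / 2))) ^ (1 - θ) :=
        mul_le_mul (Real.rpow_le_rpow (mixed_nonneg hw) e1 h0.le)
          (Real.rpow_le_rpow (mixed_nonneg hw) e2 h1'.le)
          (Real.rpow_nonneg (mixed_nonneg hw) _) (by positivity)
    _ = _ := by
      have ex : x / 2 = θ * (x₁ / 2) + (1 - θ) * (x₂ / 2) := by rw [hx]; ring
      have ey : y / 2 = θ * (y₁ / 2) + (1 - θ) * (y₂ / 2) := by rw [hy]; ring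
      rw [ex, ey, split hV₁ (by positivity) (by positivity),
        split hV₂ (by positivity) (by positivity),
        Real.mul_rpow hB₁ (by positivity), Real.mul_rpow hB₂ (by positivity),
        Real.mul_rpow (by positivity) (by positivity),
        Real.mul_rpow (by positivity) (by positivity)]
      ring

lemma crit_div_two_one_le {k : ℕ} (hk : 1 ≤ k) : 1 ≤ crit k / 2 := by
  have : (1 : ℝ) ≤ k := by exact_mod_cast hk
  unfold crit
  nlinarith

lemma norm_fsum_rpow_le (u : ι → Ω → ℂ) (ν : ι → ℤ) {q : ℕ} (hq : 0 < q) (S : Finset ι)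
    {x : ℝ} (hx : 0 < x) (ω : Ω) :
    ‖fsum u S ω‖ ^ x ≤ (q : ℝ) ^ x * ∑ J ∈ cls ν q S, ‖fsum u J ω‖ ^ x := by
  have := norm_sum_rpow_le (cls ν q S) (fun J => fsum u J ω) (n := q) (x := x)
    (by exact_mod_cast card_cls_le hq) hx
  rwa [fsum_cls] at this

/-- Indices in a residue class modulo `p ^ a` as a dilated and translated family. -/
lemma exists_reparam {p a : ℕ} (hp : 0 < p) {ν : ι → ℤ} {S : Finset ι} {i₀ : ι} (hi₀ : i₀ ∈ S)
    (hν : ∀ i ∈ S, ∀ j ∈ S, ((p ^ a : ℕ) : ℤ) ∣ ν i - ν j) :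
    ∃ m : ι → ℤ, (∀ i ∈ S, ν i = ν i₀ + p ^ a * m i) ∧
      ∀ h, cls ν (p ^ (a + h)) S = cls m (p ^ h) S := by
  have hp' : (p : ℤ) ≠ 0 := by exact_mod_cast hp.ne'
  have hνm : ∀ i ∈ S, ν i = ν i₀ + p ^ a * ((ν i - ν i₀) / (p ^ a : ℕ)) := by
    intro i hi
    have := Int.mul_ediv_cancel' (hν i hi i₀ hi₀)
    push_cast at this ⊢
    linarith
  refine ⟨fun i => (ν i - ν i₀) / (p ^ a : ℕ), hνm, fun h => cls_congr fun i hi j hj => ?_⟩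
  have e1 : ν i - ν j = p ^ a * ((ν i - ν i₀) / (p ^ a : ℕ) - (ν j - ν i₀) / (p ^ a : ℕ)) := by
    rw [mul_sub]
    linarith [hνm i hi, hνm j hj]
  have e2 : ((p ^ (a + h) : ℕ) : ℤ) = p ^ a * ((p ^ h : ℕ) : ℤ) := by
    push_cast
    rw [← pow_add]
  rw [e1, e2]
  exact mul_dvd_mul_iff_left (pow_ne_zero _ hp')

variable [Fintype Ω]

lemma sqSum_rpow_ge {k : ℕ} (hk : 1 ≤ k) {w : Ω → ℝ} (hw : ∀ ω, 0 ≤ w ω) (u : ι → Ω → ℂ)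
    (ν : ι → ℤ) (q : ℕ) (S : Finset ι) :
    ∑ J ∈ cls ν q S, moment w u (crit k) J ≤ sqSum k w u ν q S ^ (crit k / 2) := by
  have h := crit_div_two_one_le hk
  refine le_trans (le_of_eq ?_) (sum_rpow_le _ (fun J => Real.rpow_nonneg (moment_nonneg hw) _) h)
  refine Finset.sum_congr rfl fun J _ => ?_
  rw [one_div, Real.rpow_inv_rpow (moment_nonneg hw) (by linarith)]

lemma moment_empty {k : ℕ} (hk : 1 ≤ k) (w : Ω → ℝ) (u : ι → Ω → ℂ) :
    moment w u (crit k) ∅ = 0 := by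
  refine Finset.sum_eq_zero fun ω _ => ?_
  rw [fsum, Finset.sum_empty, norm_zero, Real.zero_rpow (crit_pos hk).ne', mul_zero]

/-- The trivial decoupling inequality. -/
lemma Dec.trivial {p k : ℕ} (hp : 0 < p) (hk : 1 ≤ k) (H : ℕ) :
    Dec p k H ((p : ℝ) ^ (crit k * H)) := by
  intro Ω ι _ w u ν S hs
  have hw := hs.nonneg
  have hpow : ((p ^ H : ℕ) : ℝ) ^ crit k = (p : ℝ) ^ (crit k * H) := by
    push_cast
    rw [← Real.rpow_natCast, ← Real.rpow_mul (by positivity), mul_comm]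
  rw [← hpow]
  refine le_trans ?_ (mul_le_mul_of_nonneg_left (sqSum_rpow_ge hk hw u ν (p ^ H) S)
    (by positivity))
  unfold moment
  rw [Finset.sum_comm, Finset.mul_sum]
  refine Finset.sum_le_sum fun ω _ => ?_
  rw [← Finset.mul_sum, mul_left_comm]
  exact mul_le_mul_of_nonneg_left
    (norm_fsum_rpow_le u ν (pow_pos hp H) S (crit_pos hk) ω) (hw ω)

lemma exists_dilate {d : ℕ} (c : ℤ) {P : ℤ[X]} (hP : P.natDegree ≤ d) :
    ∃ Q : ℤ[X], Q.natDegree ≤ d ∧ ∀ m, Q.eval (c * m) = c ^ d * P.eval m := by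
  refine ⟨∑ j ∈ Finset.range (d + 1), C (P.coeff j * c ^ (d - j)) * X ^ j, ?_, fun m => ?_⟩
  · refine natDegree_sum_le_of_forall_le _ _ fun j hj => ?_
    refine (natDegree_C_mul_X_pow_le _ _).trans ?_
    exact Nat.lt_succ_iff.1 (Finset.mem_range.1 hj)
  · rw [eval_finsetSum, eval_eq_sum_range' (Nat.lt_succ_of_le hP), Finset.mul_sum]
    refine Finset.sum_congr rfl fun j hj => ?_
    have hj' : j ≤ d := Nat.lt_succ_iff.1 (Finset.mem_range.1 hj)
    simp only [eval_mul, eval_C, eval_pow, eval_X]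
    have e3 : c ^ d = c ^ (d - j) * c ^ j := by rw [← pow_add, Nat.sub_add_cancel hj']
    rw [e3, mul_pow]
    ring

lemma natDegree_comp_X_sub_C_le {d : ℕ} (c : ℤ) {P : ℤ[X]} (hP : P.natDegree ≤ d) :
    (P.comp (X - C c)).natDegree ≤ d := by
  rw [natDegree_comp, natDegree_X_sub_C, mul_one]
  exact hP

/-- Parabolic rescaling. -/
lemma Dec.rescale {p k H b : ℕ} {A : ℝ} (hp : 0 < p) (hb : b ≤ H) (h : Dec p k (H - b) A)
    {w : Ω → ℝ} {u : ι → Ω → ℂ} {ν : ι → ℤ} {S : Finset ι} (hS : S.Nonempty)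
    (hs : PhaseSystem p k (k * H) w u ν S)
    (hν : ∀ i ∈ S, ∀ j ∈ S, ((p ^ b : ℕ) : ℤ) ∣ ν i - ν j) :
    moment w u (crit k) S ≤ A * sqSum k w u ν (p ^ H) S ^ (crit k / 2) := by
  obtain ⟨i₀, hi₀⟩ := hS
  obtain ⟨m, hνm, hcls⟩ := exists_reparam hp hi₀ hν
  have hsys : PhaseSystem p k (k * (H - b)) w u m S := by
    refine ⟨hs.nonneg, fun P hP => ?_⟩
    obtain ⟨Q, hQ, hQe⟩ := exists_dilate ((p : ℤ) ^ b) hP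
    obtain ⟨T, hT1, hT2⟩ := hs.shift _ (natDegree_comp_X_sub_C_le (ν i₀) hQ)
    refine ⟨T, hT1, fun i hi ω => ?_⟩
    rw [hT2 i hi ω]
    have heval : (Q.comp (X - C (ν i₀))).eval (ν i) = (p ^ b) ^ k * P.eval (m i) := by
      rw [eval_comp, eval_sub, eval_X, eval_C, hνm i hi, add_sub_cancel_left, hQe]
    congr 2
    rw [heval]
    have e4 : k * H = b * k + k * (H - b) := by
      rw [mul_comm b k, ← mul_add, Nat.add_sub_cancel' hb]
    have hpr : (p : ℝ) ≠ 0 := by exact_mod_cast hp.ne'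
    rw [e4]
    push_cast
    rw [pow_add, ← pow_mul]
    field_simp
  have := h Ω ι w u m S hsys
  rwa [sqSum, ← hcls, Nat.add_sub_cancel' hb] at this

/-- Decoupling for the second factor alone. -/
lemma Bil.of_dec {p k H a b : ℕ} {A : ℝ} (hp : 0 < p) (hk : 1 ≤ k) (hb : b ≤ H) (hA : 0 ≤ A)
    (h : Dec p k (H - b) A) : Bil p k 0 (crit k) a b H A := by
  intro Ω ι _ w u ν S₁ S₂ hs h1 h2 h3
  simp only [mixed, Real.rpow_zero, one_mul, zero_div]
  rcases S₂.eq_empty_or_nonempty with rfl | hS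
  · refine (moment_empty hk w u).le.trans ?_
    exact mul_nonneg hA (Real.rpow_nonneg (sqSum_nonneg hs.nonneg) _)
  · exact h.rescale hp hb hS (hs.mono Finset.subset_union_right) h2

end

section

open Polynomial
open scoped Classical

variable {ι Ω : Type}

section polynomials

/-- A polynomial without low-order terms at the origin and with prescribed leading order at a
point `u`. -/
lemma exists_poly_leading {p k l i : ℕ} (hp : p.Prime) (hkp : k < p) (hl : l ≤ k) (hil : i ≤ l)
    {u : ℤ} (hu : ¬ (p : ℤ) ∣ u) :
    ∃ P G : ℤ[X], ∃ c g : ℤ, P.natDegree ≤ k ∧ (∀ t, ∃ r, P.eval t = c + t ^ (k - l + 1) * r) ∧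
      ¬ (p : ℤ) ∣ g ∧ ∀ t, P.eval (u + t) = t ^ i * (g + t * G.eval t) := by
  have hpZ : Prime (p : ℤ) := Nat.prime_iff_prime_int.1 hp
  rcases Nat.eq_zero_or_pos i with rfl | hi
  · exact ⟨1, 0, 1, 1, by simp, fun t => ⟨0, by simp⟩, hpZ.not_dvd_one, fun t => by simp⟩
  set A : ℤ[X] := X ^ (k - l) * (X - C u) ^ (i - 1) with hA
  have hAdeg : A.natDegree < k := by
    refine lt_of_le_of_lt natDegree_mul_le ?_
    rw [natDegree_X_pow]
    have : ((X - C u : ℤ[X]) ^ (i - 1)).natDegree ≤ i - 1 := by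
      refine natDegree_pow_le.trans ?_
      rw [natDegree_X_sub_C, mul_one]
    omega
  set P₀ : ℤ[X] := ∑ n ∈ Finset.range k,
    C (A.coeff n * ((k.factorial / (n + 1) : ℕ) : ℤ)) * X ^ (n + 1) with hP₀
  have hder : derivative P₀ = C (k.factorial : ℤ) * A := by
    rw [hP₀, derivative_sum]
    conv_rhs => rw [A.as_sum_range' k hAdeg, Finset.mul_sum]
    refine Finset.sum_congr rfl fun n hn => ?_
    have hdvd : (n + 1) ∣ k.factorial :=
      Nat.dvd_factorial n.succ_pos (Finset.mem_range.1 hn)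
    have hd : (((k.factorial / (n + 1) : ℕ) : ℤ)) * ((n + 1 : ℕ) : ℤ) = k.factorial := by
      exact_mod_cast Nat.div_mul_cancel hdvd
    rw [derivative_C_mul_X_pow, ← C_mul_X_pow_eq_monomial, ← mul_assoc, ← C_mul,
      Nat.add_sub_cancel, mul_assoc, hd, mul_comm (A.coeff n)]
  have hdeg : P₀.natDegree ≤ k := by
    refine natDegree_sum_le_of_forall_le _ _ fun n hn => ?_
    exact (natDegree_C_mul_X_pow_le _ _).trans (Finset.mem_range.1 hn)
  have hlow : ∀ t, ∃ r, P₀.eval t = t ^ (k - l + 1) * r := by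
    intro t
    change t ^ (k - l + 1) ∣ _
    rw [hP₀, eval_finsetSum]
    refine Finset.dvd_sum fun n _ => ?_
    simp only [eval_mul, eval_C, eval_pow, eval_X]
    by_cases hn : n < k - l
    · have : A.coeff n = 0 := by
        rw [hA, coeff_X_pow_mul', if_neg (by omega)]
      rw [this]
      simp
    · exact Dvd.dvd.mul_left (pow_dvd_pow t (by omega)) _
  set G₀ : ℤ[X] := (P₀ - C (P₀.eval u)).comp (X + C u) with hG₀
  have hderG : derivative G₀ = (C (k.factorial : ℤ) * (X + C u) ^ (k - l)) * X ^ (i - 1) := by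
    rw [hG₀, derivative_comp, derivative_sub, derivative_C, sub_zero, hder, hA]
    simp
    ring
  have hcoeff : ∀ n, G₀.coeff (n + 1) * (n + 1) =
      ((C (k.factorial : ℤ) * (X + C u) ^ (k - l)) * X ^ (i - 1)).coeff n := by
    intro n
    rw [← hderG, coeff_derivative]
  have hdvd : (X : ℤ[X]) ^ i ∣ G₀ := by
    rw [X_pow_dvd_iff]
    intro n hn
    rcases n with _ | n
    · rw [coeff_zero_eq_eval_zero, hG₀, eval_comp]
      simp
    · have h := hcoeff n
      rw [coeff_mul_X_pow', if_neg (by omega)] at h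
      rcases mul_eq_zero.1 h with h | h
      · exact h
      · exfalso
        have : (0 : ℤ) < n + 1 := by positivity
        exact this.ne' h
  obtain ⟨R, hR⟩ := hdvd
  have hg : R.coeff 0 * i = k.factorial * u ^ (k - l) := by
    have h := hcoeff (i - 1)
    have h2 : G₀.coeff i = R.coeff 0 := by
      rw [hR, coeff_X_pow_mul', if_pos le_rfl, Nat.sub_self]
    have h3 : ((i - 1 : ℕ) : ℤ) + 1 = i := by omega
    rw [Nat.sub_add_cancel hi, h2, h3] at h
    rw [h, coeff_mul_X_pow', if_pos le_rfl, Nat.sub_self, coeff_zero_eq_eval_zero]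
    simp
  refine ⟨P₀ - C (P₀.eval u), R.divX, -P₀.eval u, R.coeff 0, ?_, fun t => ?_, ?_, fun t => ?_⟩
  · rw [natDegree_sub_C]
    exact hdeg
  · obtain ⟨r, hr⟩ := hlow t
    exact ⟨r, by rw [eval_sub, eval_C, hr]; ring⟩
  · intro hd
    have h1 : (p : ℤ) ∣ k.factorial * u ^ (k - l) := hg ▸ hd.mul_right _
    rcases hpZ.dvd_or_dvd h1 with h1 | h1
    · have := (hp.dvd_factorial).1 (Int.natCast_dvd_natCast.1 h1)
      omega
    · exact hu (hpZ.dvd_of_dvd_pow h1)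
  · have h1 : (P₀ - C (P₀.eval u)).eval (u + t) = G₀.eval t := by
      rw [hG₀, eval_comp]
      simp [add_comm]
    rw [h1, hR, eval_mul, eval_pow, eval_X]
    conv_lhs => rw [← R.divX_mul_X_add]
    simp only [eval_add, eval_mul, eval_X, eval_C]
    ring

/-- Hermite interpolation modulo a prime power. -/
lemma exists_poly_interpolate {p k l : ℕ} (M : ℕ) (hp : p.Prime) (hkp : k < p) (hl : l ≤ k)
    {u : ℤ} (hu : ¬ (p : ℤ) ∣ u) (Q : ℤ[X]) :
    ∃ P : ℤ[X], ∃ c : ℤ, P.natDegree ≤ k ∧ (∀ t, ∃ r, P.eval t = c + t ^ (k - l + 1) * r) ∧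
      ∀ t, ∃ r s, P.eval (u + t) = Q.eval t + t ^ (l + 1) * r + p ^ M * s := by
  have hpZ : Prime (p : ℤ) := Nat.prime_iff_prime_int.1 hp
  suffices h : ∀ d i, i + d = l + 1 → ∀ Q : ℤ[X], ∃ P : ℤ[X], ∃ c : ℤ, P.natDegree ≤ k ∧
      (∀ t, ∃ r, P.eval t = c + t ^ (k - l + 1) * r) ∧
      ∀ t, ∃ r s, P.eval (u + t) = t ^ i * Q.eval t + t ^ (l + 1) * r + p ^ M * s by
    simpa using h (l + 1) 0 (by omega) Q
  intro d
  induction d with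
  | zero =>
    intro i hi Q
    refine ⟨0, 0, by simp, fun t => ⟨0, by simp⟩, fun t => ⟨-Q.eval t, 0, ?_⟩⟩
    have : i = l + 1 := by omega
    subst this
    simp
  | succ d ih =>
    intro i hi Q
    obtain ⟨P₁, G, c₁, g, hd₁, hc₁, hg, hP₁⟩ :=
      exists_poly_leading hp hkp hl (show i ≤ l by omega) hu
    have hcop : IsCoprime ((p : ℤ) ^ M) g :=
      ((hpZ.irreducible.coprime_iff_not_dvd).2 hg).pow_left
    obtain ⟨z, g', hzg⟩ := hcop
    obtain ⟨P₂, c₂, hd₂, hc₂, hP₂⟩ := ih (i + 1) (by omega) (Q.divX - C (Q.coeff 0 * g') * G)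
    refine ⟨C (Q.coeff 0 * g') * P₁ + P₂, Q.coeff 0 * g' * c₁ + c₂, ?_, fun t => ?_, fun t => ?_⟩
    · exact natDegree_add_le_of_degree_le ((natDegree_C_mul_le _ _).trans hd₁) hd₂
    · obtain ⟨r₁, h₁⟩ := hc₁ t
      obtain ⟨r₂, h₂⟩ := hc₂ t
      refine ⟨Q.coeff 0 * g' * r₁ + r₂, ?_⟩
      rw [eval_add, eval_mul, eval_C, h₁, h₂]
      ring
    · obtain ⟨r, s, h⟩ := hP₂ t
      refine ⟨r, s - Q.coeff 0 * t ^ i * z, ?_⟩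
      have hQ : Q.eval t = Q.divX.eval t * t + Q.coeff 0 := by
        conv_lhs => rw [← Q.divX_mul_X_add]
        simp
      rw [eval_add, eval_mul, eval_C, h, hP₁, hQ]
      simp only [eval_sub, eval_mul, eval_C]
      linear_combination (Q.coeff 0 * t ^ i) * hzg

end polynomials

end

section

open Polynomial
open scoped Classical

variable {ι Ω : Type}

/-- Twisting the weight by a transversal exponential sum preserves the phase structure of lower
degree on a residue class. -/
lemma PhaseSystem.twist {p k l a b H H' : ℕ} (hp : p.Prime) (hkp : k < p) (hlk : l ≤ k)
    (h1 : l * H' ≤ a) (h2 : l * (a + H') ≤ (k - l + 1) * b) (h3 : a + H' ≤ H)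
    {w : Ω → ℝ} {u : ι → Ω → ℂ} {ν : ι → ℤ} {S₁ S₂ : Finset ι}
    (hs : PhaseSystem p k (k * H) w u ν (S₁ ∪ S₂)) {ξ η : ℤ} (hξ : ¬ (p : ℤ) ∣ ξ - η)
    {m : ι → ℤ} (hm : ∀ i ∈ S₁, ν i = ξ + p ^ a * m i)
    (hη : ∀ j ∈ S₂, ((p ^ b : ℕ) : ℤ) ∣ ν j - η) (y : ℝ) :
    PhaseSystem p l (l * H') (fun ω => w ω * ‖fsum u S₂ ω‖ ^ y) u m S₁ := by
  refine ⟨fun ω => mul_nonneg (hs.nonneg ω) (by positivity), fun Q hQ => ?_⟩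
  have hp0 : p ≠ 0 := hp.ne_zero
  obtain ⟨Q₀, -, hQ₀⟩ := exists_dilate ((p : ℤ) ^ a) hQ
  obtain ⟨P₀, c, hP₀, hlow, hint⟩ := exists_poly_interpolate (k * H) hp hkp hlk hξ Q₀
  have hle : l * H' + a * l ≤ k * H := by
    calc l * H' + a * l = l * (a + H') := by ring
      _ ≤ k * H := Nat.mul_le_mul hlk h3
  obtain ⟨e, he⟩ := Nat.exists_eq_add_of_le hle
  obtain ⟨T, hT1, hT2⟩ := hs.shift (C ((p : ℤ) ^ e) * P₀.comp (X - C η))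
    ((natDegree_C_mul_le _ _).trans (natDegree_comp_X_sub_C_le _ hP₀))
  have heval : ∀ n : ℤ, (C ((p : ℤ) ^ e) * P₀.comp (X - C η)).eval n = p ^ e * P₀.eval (n - η) := by
    intro n
    simp [eval_comp]
  have hq : p ^ (k * H) ≠ 0 := pow_ne_zero _ hp0
  have hS₂ : ∀ ω, ‖fsum u S₂ (T ω)‖ = ‖fsum u S₂ ω‖ := by
    intro ω
    have : fsum u S₂ (T ω) = ee (((p ^ e * c : ℤ) : ℝ) / (p ^ (k * H) : ℕ)) * fsum u S₂ ω := by
      rw [fsum, fsum, Finset.mul_sum]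
      refine Finset.sum_congr rfl fun j hj => ?_
      rw [hT2 j (Finset.mem_union_right _ hj) ω, heval]
      congr 1
      refine ee_div_congr hq ?_
      obtain ⟨t, ht⟩ := hη j hj
      obtain ⟨r, hr⟩ := hlow (ν j - η)
      rw [hr, ht]
      push_cast
      have e1 : (p : ℤ) ^ e * (c + (p ^ b * t) ^ (k - l + 1) * r) - p ^ e * c =
          p ^ (e + b * (k - l + 1)) * (t ^ (k - l + 1) * r) := by
        rw [mul_pow, ← pow_mul, pow_add]
        ring
      rw [e1]
      refine Dvd.dvd.mul_right (pow_dvd_pow _ ?_) _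
      have : l * (a + H') = l * H' + a * l := by ring
      have : (k - l + 1) * b = b * (k - l + 1) := by ring
      omega
    rw [this, norm_mul, norm_ee, one_mul]
  refine ⟨T, fun ω => by simp only [hT1, hS₂], fun i hi ω => ?_⟩
  rw [hT2 i (Finset.mem_union_left _ hi) ω, heval]
  congr 1
  have e2 : ((Q.eval (m i) : ℤ) : ℝ) / (p ^ (l * H') : ℕ) =
      ((p ^ (e + a * l) * Q.eval (m i) : ℤ) : ℝ) / (p ^ (k * H) : ℕ) := by
    have hpr : (p : ℝ) ≠ 0 := by exact_mod_cast hp0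
    rw [he]
    push_cast
    rw [pow_add, pow_add, pow_add]
    field_simp
  rw [e2]
  refine ee_div_congr hq ?_
  obtain ⟨r, s, hrs⟩ := hint (p ^ a * m i)
  have e3 : ν i - η = ξ - η + p ^ a * m i := by rw [hm i hi]; ring
  rw [e3, hrs, hQ₀]
  have e4 : (p : ℤ) ^ e * ((p ^ a) ^ l * Q.eval (m i) + (p ^ a * m i) ^ (l + 1) * r
      + p ^ (k * H) * s) - p ^ (e + a * l) * Q.eval (m i) =
      p ^ (e + a * (l + 1)) * (m i ^ (l + 1) * r) + p ^ (k * H) * (p ^ e * s) := by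
    rw [mul_pow, ← pow_mul, ← pow_mul, pow_add, pow_add]
    ring
  rw [e4]
  push_cast
  refine dvd_add (Dvd.dvd.mul_right (pow_dvd_pow _ ?_) _) (Dvd.intro _ rfl)
  have : a * (l + 1) = a * l + a := by ring
  omega

lemma fsum_empty (u : ι → Ω → ℂ) (ω : Ω) : fsum u ∅ ω = 0 := Finset.sum_empty

variable [Fintype Ω]

lemma mixed_empty_left (w : Ω → ℝ) (u : ι → Ω → ℂ) {x : ℝ} (hx : x ≠ 0) (y : ℝ)
    (S : Finset ι) : mixed w u x y ∅ S = 0 := by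
  refine Finset.sum_eq_zero fun ω _ => ?_
  rw [fsum_empty, norm_zero, Real.zero_rpow hx, zero_mul, mul_zero]

lemma mixed_empty_right (w : Ω → ℝ) (u : ι → Ω → ℂ) {y : ℝ} (hy : y ≠ 0) (x : ℝ)
    (S : Finset ι) : mixed w u x y S ∅ = 0 := by
  rw [mixed_comm, mixed_empty_left w u hy]

/-- Lower degree decoupling refines the first class of a bilinear decoupling inequality. -/
lemma Bil.lower {p k l a b H H' : ℕ} {y A B : ℝ} (hp : p.Prime) (hkp : k < p) (hl : 1 ≤ l)
    (hlk : l ≤ k) (h1 : l * H' ≤ a) (h2 : l * (a + H') ≤ (k - l + 1) * b) (h3 : a + H' ≤ H)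
    (hy : 0 < y) (hA : 0 ≤ A) (hB : 0 ≤ B) (hdec : Dec p l H' A)
    (h : Bil p k (crit l) y (a + H') b H B) : Bil p k (crit l) y a b H (A * B) := by
  intro Ω ι _ w u ν S₁ S₂ hs hS₁ hS₂ htr
  have hw := hs.nonneg
  have hcl := crit_pos hl
  have hrhs : 0 ≤ A * B * (sqSum k w u ν (p ^ H) S₁ ^ (crit l / 2) *
      sqSum k w u ν (p ^ H) S₂ ^ (y / 2)) :=
    mul_nonneg (mul_nonneg hA hB) (mul_nonneg (Real.rpow_nonneg (sqSum_nonneg hw) _)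
      (Real.rpow_nonneg (sqSum_nonneg hw) _))
  rcases S₁.eq_empty_or_nonempty with rfl | ⟨i₀, hi₀⟩
  · rwa [mixed_empty_left w u hcl.ne']
  rcases S₂.eq_empty_or_nonempty with rfl | ⟨j₀, hj₀⟩
  · rwa [mixed_empty_right w u hy.ne']
  obtain ⟨m, hm, hcls⟩ := exists_reparam hp.pos hi₀ hS₁
  have hsys := hs.twist hp hkp hlk h1 h2 h3 (htr i₀ hi₀ j₀ hj₀) hm (fun j hj => hS₂ j hj j₀ hj₀) y
  have hmom : ∀ J : Finset ι, moment (fun ω => w ω * ‖fsum u S₂ ω‖ ^ y) u (crit l) J =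
      mixed w u (crit l) y J S₂ := fun J => Finset.sum_congr rfl fun ω _ => by ring
  have hmain := hdec Ω ι _ u m S₁ hsys
  rw [hmom] at hmain
  refine hmain.trans ?_
  set Y := sqSum k w u ν (p ^ H) S₂ with hY
  have hY0 : 0 ≤ Y := sqSum_nonneg hw
  have hpos : 0 < crit l / 2 := by positivity
  have hsq : sqSum l (fun ω => w ω * ‖fsum u S₂ ω‖ ^ y) u m (p ^ H') S₁ ≤
      (B * Y ^ (y / 2)) ^ (1 / (crit l / 2)) * sqSum k w u ν (p ^ H) S₁ := by
    rw [sqSum, ← hcls, ← sum_sqSum (S := S₁) (pow_dvd_pow p h3), Finset.mul_sum]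
    refine Finset.sum_le_sum fun J hJ => ?_
    have hJS := subset_of_mem_cls hJ
    rw [hmom]
    have hb := h Ω ι w u ν J S₂ (hs.mono (Finset.union_subset_union_left hJS))
      (fun i hi j hj => dvd_of_mem_cls hJ hi hj) hS₂ fun i hi j hj => htr i (hJS hi) j hj
    refine (Real.rpow_le_rpow (mixed_nonneg hw) hb (by positivity)).trans (le_of_eq ?_)
    rw [← hY, mul_comm (_ ^ (crit l / 2)), ← mul_assoc, Real.mul_rpow (by positivity)
      (Real.rpow_nonneg (sqSum_nonneg hw) _), one_div, Real.rpow_rpow_inv (sqSum_nonneg hw) hpos.ne']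
  rw [mul_assoc]
  refine mul_le_mul_of_nonneg_left ?_ hA
  refine (Real.rpow_le_rpow (sqSum_nonneg hsys.nonneg) hsq hpos.le).trans (le_of_eq ?_)
  rw [Real.mul_rpow (by positivity) (sqSum_nonneg hw), one_div, Real.rpow_inv_rpow (by positivity)
    hpos.ne']
  ring

end

section

open Polynomial
open scoped Classical ComplexConjugate

lemma conj_ee (x : ℝ) : conj (ee x) = ee (-x) := by
  rw [ee, ee, ← Complex.exp_conj]
  congr 1
  simp only [map_mul, Complex.conj_ofReal, Complex.conj_I, map_ofNat]
  push_cast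
  ring

variable {ι Ω : Type} [Fintype Ω]

lemma Dec.zero (p : ℕ) {k : ℕ} (hk : 1 ≤ k) : Dec p k 0 1 := by
  intro Ω ι _ w u ν S hs
  rcases S.eq_empty_or_nonempty with rfl | hS
  · rw [moment_empty hk, one_mul]
    exact Real.rpow_nonneg (sqSum_nonneg hs.nonneg) _
  · rw [sqSum, cls_of_forall_dvd hS (fun i _ j _ => by simp), Finset.sum_singleton, one_mul, one_div,
      Real.rpow_inv_rpow (moment_nonneg hs.nonneg) (half_pos (crit_pos hk)).ne']

/-- Pieces living on different residue classes are orthogonal. -/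
lemma orthogonal_pieces {p k H : ℕ} (hp : 0 < p) (hk : 1 ≤ k) {w : Ω → ℝ} {u : ι → Ω → ℂ}
    {ν : ι → ℤ} {S : Finset ι} (hs : PhaseSystem p k H w u ν S) {J J' : Finset ι}
    (hJ : J ∈ cls ν (p ^ H) S) (hJ' : J' ∈ cls ν (p ^ H) S) (hne : J ≠ J') :
    ∑ ω, (w ω : ℂ) * (fsum u J ω * conj (fsum u J' ω)) = 0 := by
  obtain ⟨T, hT1, hT2⟩ := hs.shift X (natDegree_X_le.trans hk)
  have hq : p ^ H ≠ 0 := (pow_pos hp H).ne'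
  have key : ∀ K ∈ cls ν (p ^ H) S, ∀ i ∈ K, ∀ ω,
      fsum u K (T ω) = ee ((ν i : ℝ) / (p ^ H : ℕ)) * fsum u K ω := by
    intro K hK i hi ω
    rw [fsum, fsum, Finset.mul_sum]
    refine Finset.sum_congr rfl fun j hj => ?_
    rw [hT2 j (subset_of_mem_cls hK hj), eval_X, ee_div_congr hq (dvd_of_mem_cls hK hj hi)]
  obtain ⟨i, hi⟩ := nonempty_of_mem_cls hJ
  obtain ⟨j, hj⟩ := nonempty_of_mem_cls hJ'
  set I := ∑ ω, (w ω : ℂ) * (fsum u J ω * conj (fsum u J' ω)) with hI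
  have h1 : I = ee (((ν i - ν j : ℤ) : ℝ) / (p ^ H : ℕ)) * I := by
    conv_lhs => rw [hI, ← Equiv.sum_comp T]
    rw [hI, Finset.mul_sum]
    refine Finset.sum_congr rfl fun ω _ => ?_
    rw [hT1, key J hJ i hi, key J' hJ' j hj, map_mul, conj_ee]
    have : ((ν i - ν j : ℤ) : ℝ) / (p ^ H : ℕ) =
        (ν i : ℝ) / (p ^ H : ℕ) + -((ν j : ℝ) / (p ^ H : ℕ)) := by
      push_cast
      ring
    rw [this, ee_add]
    ring
  have h2 : ee (((ν i - ν j : ℤ) : ℝ) / (p ^ H : ℕ)) ≠ 1 := by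
    rw [Ne, ee_eq_one_iff]
    rintro ⟨n, hn⟩
    refine not_dvd_of_cls_ne hJ hJ' hne hi hj ⟨n, ?_⟩
    have hqr : ((p ^ H : ℕ) : ℝ) ≠ 0 := by exact_mod_cast hq
    rw [div_eq_iff hqr] at hn
    rw [mul_comm]
    exact_mod_cast hn
  have h3 : (ee (((ν i - ν j : ℤ) : ℝ) / (p ^ H : ℕ)) - 1) * I = 0 := by
    rw [sub_mul, ← h1, one_mul, sub_self]
  exact (mul_eq_zero.1 h3).resolve_left (sub_ne_zero.2 h2)

lemma Dec.one {p : ℕ} (hp : 0 < p) (H : ℕ) : Dec p 1 H 1 := by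
  intro Ω ι _ w u ν S hs
  have hc : crit 1 = 2 := by norm_num [crit]
  have hs' : PhaseSystem p 1 H w u ν S := by simpa using hs
  have hmom : ∀ K : Finset ι, ((moment w u 2 K : ℝ) : ℂ) =
      ∑ ω, (w ω : ℂ) * (fsum u K ω * conj (fsum u K ω)) := by
    intro K
    rw [moment]
    push_cast
    refine Finset.sum_congr rfl fun ω _ => ?_
    rw [Complex.mul_conj']
    norm_cast
  rw [sqSum, hc]
  norm_num
  refine le_of_eq ?_
  have : ((moment w u 2 S : ℝ) : ℂ) = ((∑ J ∈ cls ν (p ^ H) S, moment w u 2 J : ℝ) : ℂ) := by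
    rw [hmom]
    push_cast
    simp_rw [hmom]
    rw [Finset.sum_comm]
    calc ∑ ω, (w ω : ℂ) * (fsum u S ω * conj (fsum u S ω))
        = ∑ ω, ∑ J ∈ cls ν (p ^ H) S, ∑ J' ∈ cls ν (p ^ H) S,
            (w ω : ℂ) * (fsum u J ω * conj (fsum u J' ω)) := by
          refine Finset.sum_congr rfl fun ω _ => ?_
          rw [← fsum_cls u ν (p ^ H) S ω, map_sum, Finset.sum_mul_sum, Finset.mul_sum]
          simp_rw [Finset.mul_sum]
      _ = ∑ J ∈ cls ν (p ^ H) S, ∑ J' ∈ cls ν (p ^ H) S, ∑ ω,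
            (w ω : ℂ) * (fsum u J ω * conj (fsum u J' ω)) := by
          rw [Finset.sum_comm]
          refine Finset.sum_congr rfl fun J _ => ?_
          rw [Finset.sum_comm]
      _ = _ := by
          rw [Finset.sum_comm (s := Finset.univ)]
          refine Finset.sum_congr rfl fun J hJ => ?_
          rw [Finset.sum_eq_single J]
          · intro J' hJ' hne
            exact orthogonal_pieces hp le_rfl hs' hJ hJ' hne.symm
          · intro h
            exact absurd hJ h
  exact_mod_cast this

/-- Bilinear decoupling and rescaled linear decoupling imply linear decoupling. -/
lemma Dec.of_bil {p k H : ℕ} {A B : ℝ} (hp : 0 < p) (hk : 1 ≤ k) (hH : 1 ≤ H) (hA : 0 ≤ A)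
    (hB : 0 ≤ B) (hdec : Dec p k (H - 1) A)
    (hbil : Bil p k (crit k / 2) (crit k / 2) 0 0 H B) :
    Dec p k H ((A ^ (1 / (crit k / 2)) + p ^ 2 * B ^ (1 / (crit k / 2))) ^ (crit k / 2)) := by
  intro Ω ι _ w u ν S hs
  have hw := hs.nonneg
  have hs1 := crit_div_two_one_le hk
  set s := crit k / 2 with hsdef
  have hs0 : 0 < s := by linarith
  have hinv : 0 ≤ 1 / s := by positivity
  have hcs : crit k = 2 * s := by rw [hsdef]; ring
  set X := sqSum k w u ν (p ^ H) S with hX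
  have hX0 : 0 ≤ X := sqSum_nonneg hw
  set D := cls ν p S with hD
  have hpH : p ∣ p ^ H := dvd_pow_self p (by omega)
  have hmono : moment w u (crit k) S ^ (1 / s) ≤
      ∑ P ∈ D ×ˢ D, (∑ ω, w ω * (‖fsum u P.1 ω‖ * ‖fsum u P.2 ω‖) ^ s) ^ (1 / s) := by
    refine le_trans (Real.rpow_le_rpow (moment_nonneg hw) ?_ hinv)
      (minkowski_weighted hw hs1 (D ×ˢ D) (fun P ω => ‖fsum u P.1 ω‖ * ‖fsum u P.2 ω‖)
        fun P ω => by positivity)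
    refine Finset.sum_le_sum fun ω _ => mul_le_mul_of_nonneg_left ?_ (hw ω)
    rw [hcs, Real.rpow_mul (norm_nonneg _)]
    refine Real.rpow_le_rpow (by positivity) ?_ hs0.le
    simp only [Finset.sum_product]
    rw [← Finset.sum_mul_sum, Real.rpow_two, sq, ← fsum_cls u ν p S ω]
    exact mul_le_mul (norm_sum_le _ _) (norm_sum_le _ _) (norm_nonneg _)
      (Finset.sum_nonneg fun _ _ => norm_nonneg _)
  have hterm : ∀ P ∈ D ×ˢ D, (∑ ω, w ω * (‖fsum u P.1 ω‖ * ‖fsum u P.2 ω‖) ^ s) ^ (1 / s) ≤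
      (if P.1 = P.2 then A ^ (1 / s) * sqSum k w u ν (p ^ H) P.1 else 0) + B ^ (1 / s) * X := by
    rintro ⟨J, J'⟩ hP
    obtain ⟨hJ, hJ'⟩ := Finset.mem_product.1 hP
    simp only at hJ hJ' ⊢
    have hBX : 0 ≤ B ^ (1 / s) * X := by positivity
    split_ifs with heq
    · subst heq
      refine le_trans ?_ (le_add_of_nonneg_right hBX)
      have h1 : ∑ ω, w ω * (‖fsum u J ω‖ * ‖fsum u J ω‖) ^ s = moment w u (crit k) J := by
        refine Finset.sum_congr rfl fun ω _ => ?_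
        rw [hcs, Real.rpow_mul (norm_nonneg _), Real.rpow_two, sq]
      have h2 := hdec.rescale hp hH (nonempty_of_mem_cls hJ) (hs.mono (subset_of_mem_cls hJ))
        (fun i hi j hj => by rw [pow_one]; exact dvd_of_mem_cls hJ hi hj)
      rw [h1]
      refine (Real.rpow_le_rpow (moment_nonneg hw) h2 hinv).trans (le_of_eq ?_)
      rw [Real.mul_rpow hA (Real.rpow_nonneg (sqSum_nonneg hw) _), ← hsdef, one_div,
        Real.rpow_rpow_inv (sqSum_nonneg hw) hs0.ne']
    · rw [zero_add]
      have h1 : ∑ ω, w ω * (‖fsum u J ω‖ * ‖fsum u J' ω‖) ^ s = mixed w u s s J J' := by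
        refine Finset.sum_congr rfl fun ω _ => ?_
        rw [Real.mul_rpow (norm_nonneg _) (norm_nonneg _)]
      have h2 := hbil Ω ι w u ν J J'
        (hs.mono (Finset.union_subset (subset_of_mem_cls hJ) (subset_of_mem_cls hJ')))
        (fun i _ j _ => by simp) (fun i _ j _ => by simp)
        (fun i hi j hj => not_dvd_of_cls_ne hJ hJ' heq hi hj)
      have h3 : sqSum k w u ν (p ^ H) J ^ (s / 2) * sqSum k w u ν (p ^ H) J' ^ (s / 2) ≤
          X ^ s := by
        have e : X ^ s = X ^ (s / 2) * X ^ (s / 2) := by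
          rw [← Real.rpow_add_of_nonneg hX0 (by positivity) (by positivity)]
          ring_nf
        rw [e]
        exact mul_le_mul
          (Real.rpow_le_rpow (sqSum_nonneg hw) (sqSum_le_of_mem_cls hw hpH hJ) (by positivity))
          (Real.rpow_le_rpow (sqSum_nonneg hw) (sqSum_le_of_mem_cls hw hpH hJ') (by positivity))
          (Real.rpow_nonneg (sqSum_nonneg hw) _) (by positivity)
      rw [h1]
      refine (Real.rpow_le_rpow (mixed_nonneg hw)
        (h2.trans (mul_le_mul_of_nonneg_left h3 hB)) hinv).trans (le_of_eq ?_)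
      rw [Real.mul_rpow hB (by positivity), one_div, Real.rpow_rpow_inv hX0 hs0.ne']
  have hcard : ((D ×ˢ D).card : ℝ) ≤ (p : ℝ) ^ 2 := by
    rw [Finset.card_product, sq]
    have : (D.card : ℝ) ≤ p := by exact_mod_cast card_cls_le hp
    push_cast
    exact mul_le_mul this this (Nat.cast_nonneg _) (Nat.cast_nonneg _)
  have htot : moment w u (crit k) S ^ (1 / s) ≤ (A ^ (1 / s) + p ^ 2 * B ^ (1 / s)) * X := by
    refine (hmono.trans (Finset.sum_le_sum hterm)).trans ?_
    rw [Finset.sum_add_distrib, Finset.sum_const, nsmul_eq_mul, Finset.sum_product, add_mul _ _ X]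
    refine add_le_add (le_of_eq ?_) ?_
    · have hXD : X = ∑ J ∈ D, sqSum k w u ν (p ^ H) J := (sum_sqSum hpH).symm
      rw [hXD, Finset.mul_sum]
      refine Finset.sum_congr rfl fun J hJ => ?_
      rw [Finset.sum_ite_eq, if_pos hJ]
    · rw [mul_assoc]
      exact mul_le_mul_of_nonneg_right hcard (by positivity)
  have hfin := Real.rpow_le_rpow (Real.rpow_nonneg (moment_nonneg hw) _) htot hs0.le
  rw [Real.mul_rpow (by positivity) hX0] at hfin
  rwa [← Real.rpow_mul (moment_nonneg hw), one_div_mul_cancel hs0.ne', Real.rpow_one] at hfin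

/-- Removing the localization to small classes from a bilinear decoupling inequality. -/
lemma Bil.shrink {p k a b H : ℕ} {x y B : ℝ} (hp : 0 < p) (hx : 0 < x) (hy : 0 < y) (ha : a ≤ H)
    (hb : b ≤ H) (hB : 0 ≤ B) (h : Bil p k x y a b H B) :
    Bil p k x y 0 0 H (((p ^ a : ℕ) : ℝ) ^ x * ((p ^ b : ℕ) : ℝ) ^ y *
      ((p ^ a : ℕ) * (p ^ b : ℕ)) * B) := by
  intro Ω ι _ w u ν S₁ S₂ hs _ _ htr
  have hw := hs.nonneg
  set qa := p ^ a with hqa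
  set qb := p ^ b with hqb
  have hqa0 : 0 < qa := pow_pos hp a
  have hqb0 : 0 < qb := pow_pos hp b
  set R := sqSum k w u ν (p ^ H) S₁ ^ (x / 2) * sqSum k w u ν (p ^ H) S₂ ^ (y / 2) with hR
  have hR0 : 0 ≤ R := mul_nonneg (Real.rpow_nonneg (sqSum_nonneg hw) _)
    (Real.rpow_nonneg (sqSum_nonneg hw) _)
  have h1 : mixed w u x y S₁ S₂ ≤ (qa : ℝ) ^ x * (qb : ℝ) ^ y *
      ∑ J ∈ cls ν qa S₁, ∑ J' ∈ cls ν qb S₂, mixed w u x y J J' := by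
    have : ∑ J ∈ cls ν qa S₁, ∑ J' ∈ cls ν qb S₂, mixed w u x y J J' =
        ∑ ω, w ω * ((∑ J ∈ cls ν qa S₁, ‖fsum u J ω‖ ^ x) *
          ∑ J' ∈ cls ν qb S₂, ‖fsum u J' ω‖ ^ y) := by
      simp_rw [mixed]
      rw [Finset.sum_congr rfl fun J _ => Finset.sum_comm, Finset.sum_comm]
      refine Finset.sum_congr rfl fun ω _ => ?_
      rw [Finset.sum_mul_sum, Finset.mul_sum]
      simp_rw [Finset.mul_sum]
    rw [this, mixed, Finset.mul_sum]
    refine Finset.sum_le_sum fun ω _ => ?_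
    rw [mul_left_comm (_ * _) (w ω)]
    refine mul_le_mul_of_nonneg_left ?_ (hw ω)
    rw [mul_mul_mul_comm]
    exact mul_le_mul (norm_fsum_rpow_le u ν hqa0 S₁ hx ω) (norm_fsum_rpow_le u ν hqb0 S₂ hy ω)
      (by positivity) (by positivity)
  refine h1.trans ?_
  rw [mul_assoc (_ * _) _ B, mul_assoc (_ * _) _ R]
  refine mul_le_mul_of_nonneg_left ?_ (mul_nonneg (Real.rpow_nonneg (Nat.cast_nonneg _) _)
    (Real.rpow_nonneg (Nat.cast_nonneg _) _))
  have h2 : ∀ J ∈ cls ν qa S₁, ∀ J' ∈ cls ν qb S₂, mixed w u x y J J' ≤ B * R := by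
    intro J hJ J' hJ'
    have hJs := subset_of_mem_cls hJ
    have hJs' := subset_of_mem_cls hJ'
    refine (h Ω ι w u ν J J' (hs.mono (Finset.union_subset_union hJs hJs'))
      (fun i hi j hj => dvd_of_mem_cls hJ hi hj) (fun i hi j hj => dvd_of_mem_cls hJ' hi hj)
      (fun i hi j hj => htr i (hJs hi) j (hJs' hj))).trans ?_
    refine mul_le_mul_of_nonneg_left ?_ hB
    exact mul_le_mul
      (Real.rpow_le_rpow (sqSum_nonneg hw) (sqSum_le_of_mem_cls hw (pow_dvd_pow p ha) hJ)
        (by positivity))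
      (Real.rpow_le_rpow (sqSum_nonneg hw) (sqSum_le_of_mem_cls hw (pow_dvd_pow p hb) hJ')
        (by positivity))
      (Real.rpow_nonneg (sqSum_nonneg hw) _) (Real.rpow_nonneg (sqSum_nonneg hw) _)
  calc ∑ J ∈ cls ν qa S₁, ∑ J' ∈ cls ν qb S₂, mixed w u x y J J'
      ≤ ∑ J ∈ cls ν qa S₁, ∑ J' ∈ cls ν qb S₂, B * R :=
        Finset.sum_le_sum fun J hJ => Finset.sum_le_sum fun J' hJ' => h2 J hJ J' hJ'
    _ = (cls ν qa S₁).card * ((cls ν qb S₂).card * (B * R)) := by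
        simp only [Finset.sum_const, nsmul_eq_mul]
    _ ≤ qa * (qb * (B * R)) := by
        have c1 : ((cls ν qa S₁).card : ℝ) ≤ qa := by exact_mod_cast card_cls_le hqa0
        have c2 : ((cls ν qb S₂).card : ℝ) ≤ qb := by exact_mod_cast card_cls_le hqb0
        have hBR : 0 ≤ B * R := mul_nonneg hB hR0
        gcongr
    _ = _ := by ring

end

section

open scoped Nat

/-- The decoupling constants in degree `k` grow at most like `p ^ (L * H)`. -/
def DecBound (p k : ℕ) (L : ℝ) : Prop :=
  ∃ C : ℝ, 1 ≤ C ∧ ∀ H : ℕ, Dec p k H (C * (p : ℝ) ^ (L * H))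

/-- Iterated refinement of the first class of a bilinear decoupling inequality. -/
lemma Bil.raise {p k l h a b H : ℕ} {y ε C : ℝ} (hp : p.Prime) (hkp : k < p) (hl : 1 ≤ l)
    (hlk : l ≤ k) (hy : 0 < y) (hC : 1 ≤ C)
    (hdec : ∀ H' : ℕ, Dec p l H' (C * (p : ℝ) ^ (ε * H'))) (hla : l * h ≤ a) (j : ℕ) :
    ∀ (d : ℕ) (B : ℝ), 0 ≤ B → d ≤ j * h → a + d ≤ H → l * (a + d) ≤ (k - l + 1) * b →
      Bil p k (crit l) y (a + d) b H B →
      Bil p k (crit l) y a b H (C ^ j * (p : ℝ) ^ (ε * d) * B) := by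
  have hp0 : (0 : ℝ) < p := by exact_mod_cast hp.pos
  induction j with
  | zero =>
    intro d B hB hd _ _ hb
    obtain rfl : d = 0 := by omega
    simpa using hb
  | succ j ih =>
    intro d B hB hd hH hlb hb
    obtain ⟨d', H', rfl, hd', hH'⟩ : ∃ d' H', d = d' + H' ∧ d' ≤ j * h ∧ H' ≤ h := by
      refine ⟨d - min h d, min h d, by omega, ?_, min_le_left _ _⟩
      rw [add_mul, one_mul] at hd
      omega
    have h1 : l * H' ≤ a + d' := (Nat.mul_le_mul_left l hH').trans (hla.trans (Nat.le_add_right _ _))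
    rw [← add_assoc] at hH hlb hb
    have hlow := Bil.lower hp hkp hl hlk h1 hlb hH hy (by positivity) hB (hdec H') hb
    have := ih d' _ (by positivity) hd' (by omega)
      (le_trans (Nat.mul_le_mul_left l (by omega)) hlb) hlow
    refine this.mono (le_of_eq ?_)
    push_cast
    rw [mul_add, Real.rpow_add hp0, pow_succ]
    ring

/-- The family of bilinear estimates with exponents `crit l`, `crit k - crit l` at the scales
`l * a = (k - l + 1) * b`, with gain `e l`. -/
def Gain (p k Q : ℕ) (e : ℕ → ℝ) (L : ℝ) : Prop :=
  ∀ l, 1 ≤ l → l < k → ∃ C : ℝ, 0 ≤ C ∧ ∀ H b a : ℕ, Q ∣ b → Q * b ≤ H →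
    l * a = (k - l + 1) * b →
      Bil p k (crit l) (crit k - crit l) a b H (C * (p : ℝ) ^ (L * H - e l * b))

lemma crit_lt {l k : ℕ} (h : l < k) : crit l < crit k := by
  have h1 : (l : ℝ) < k := by exact_mod_cast h
  have h2 : (0 : ℝ) ≤ l := Nat.cast_nonneg l
  unfold crit
  nlinarith

lemma crit_zero : crit 0 = 0 := by simp [crit]

lemma scale_le {k l a b : ℕ} (hl : 1 ≤ l) (h : l * a ≤ (k - l + 1) * b) (hlk : l ≤ k) :
    a ≤ k * b := by
  have h1 : a ≤ l * a := Nat.le_mul_of_pos_left _ hl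
  have h2 : (k - l + 1) * b ≤ k * b := Nat.mul_le_mul_right _ (by omega)
  omega

/-- Gains at the critical scales extend to coarser first classes. -/
lemma Gain.coarsen {p k Q : ℕ} {e : ℕ → ℝ} {L ε : ℝ} (hp : p.Prime) (hkp : k < p) (hk : 1 ≤ k)
    (hQ : (k !) ^ 2 ∣ Q) (hQ0 : 0 < Q) (hε : 0 < ε) (he0 : e 0 ≤ L)
    (hlow : ∀ l, 1 ≤ l → l < k → ∀ δ : ℝ, 0 < δ → DecBound p l δ) (hL : DecBound p k L)
    (h : Gain p k Q e L) {l : ℕ} (hlk : l < k) :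
    ∃ C : ℝ, 0 ≤ C ∧ ∀ H b a : ℕ, Q ∣ b → Q * b ≤ H → b ≤ k * a → l * a ≤ (k - l + 1) * b →
      Bil p k (crit l) (crit k - crit l) a b H (C * (p : ℝ) ^ (L * H - e l * b + ε * b)) := by
  have hp1 : (1 : ℝ) ≤ p := by exact_mod_cast hp.one_le
  have hp0 : (0 : ℝ) < p := by exact_mod_cast hp.pos
  have hkQ : k ^ 2 ∣ Q := (pow_dvd_pow_of_dvd (Nat.dvd_factorial hk le_rfl) 2).trans hQ
  have hkQ' : k ≤ Q :=
    (Nat.le_self_pow two_ne_zero k).trans (Nat.le_of_dvd hQ0 hkQ)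
  rcases Nat.eq_zero_or_pos l with rfl | hl
  · obtain ⟨C, hC, hdec⟩ := hL
    refine ⟨C, by linarith, fun H b a _ hbH _ _ => ?_⟩
    rw [crit_zero, sub_zero]
    have hb : b ≤ H := (Nat.le_mul_of_pos_left b hQ0).trans hbH
    refine (Bil.of_dec hp.pos hk hb (by positivity) (hdec (H - b))).mono ?_
    refine mul_le_mul_of_nonneg_left (Real.rpow_le_rpow_of_exponent_le hp1 ?_) (by linarith)
    rw [Nat.cast_sub hb]
    have hb0 : (0 : ℝ) ≤ b := Nat.cast_nonneg b
    nlinarith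
  · obtain ⟨C, hC, hg⟩ := h l hl hlk
    have hk0 : (0 : ℝ) < k := by exact_mod_cast hk
    obtain ⟨C₁, hC₁, hdec⟩ := hlow l hl hlk (ε / k) (by positivity)
    refine ⟨C₁ ^ (k ^ 3) * C, by positivity, fun H b a hQb hbH hba hla => ?_⟩
    have hlb : l ∣ (k - l + 1) * b := by
      refine Dvd.dvd.mul_left ?_ _
      exact (Nat.dvd_factorial hl hlk.le).trans ((dvd_pow_self _ two_ne_zero).trans (hQ.trans hQb))
    obtain ⟨A, hA⟩ := hlb
    have hAk : A ≤ k * b := scale_le hl hA.ge hlk.le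
    have hAH : A ≤ H := hAk.trans ((Nat.mul_le_mul_right b hkQ').trans hbH)
    have haA : a ≤ A := by
      rw [hA] at hla
      exact Nat.le_of_mul_le_mul_left hla hl
    obtain ⟨d, rfl⟩ := Nat.exists_eq_add_of_le haA
    obtain ⟨h', hh'⟩ := hkQ.trans hQb
    have h1 : l * h' ≤ a := by
      have h2 : k * (k * h') ≤ k * a := by
        rw [← mul_assoc, ← sq, ← hh']
        exact hba
      exact (Nat.mul_le_mul_right h' hlk.le).trans (Nat.le_of_mul_le_mul_left h2 hk)
    have hd : d ≤ k ^ 3 * h' := by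
      calc d ≤ k * b := by omega
        _ = k ^ 3 * h' := by rw [hh']; ring
    have hr := Bil.raise hp hkp hl hlk.le (sub_pos.2 (crit_lt hlk)) hC₁ hdec h1 (k ^ 3) d _
      (by positivity) hd hAH hA.ge (hg H b _ hQb hbH hA.symm)
    refine hr.mono ?_
    have e1 : C₁ ^ k ^ 3 * (p : ℝ) ^ (ε / k * d) * (C * (p : ℝ) ^ (L * H - e l * b)) =
        C₁ ^ k ^ 3 * C * (p : ℝ) ^ (L * H - e l * b + ε / k * d) := by
      rw [Real.rpow_add hp0]
      ring
    rw [e1]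
    refine mul_le_mul_of_nonneg_left (Real.rpow_le_rpow_of_exponent_le hp1 ?_) (by positivity)
    have hdk : (d : ℝ) ≤ k * b := by
      have : d ≤ k * b := by omega
      exact_mod_cast this
    have : ε / k * d ≤ ε * b := by
      calc ε / k * d ≤ ε / k * (k * b) := mul_le_mul_of_nonneg_left hdk (by positivity)
        _ = ε * b := by field_simp
    linarith

/-- The initial family of estimates, without gain. -/
lemma Gain.initial {p k : ℕ} {e : ℕ → ℝ} {L : ℝ} (hp : p.Prime) (hk : 1 ≤ k) (hL0 : 0 ≤ L)
    (he : ∀ l, 1 ≤ l → e l = 0) (hL : DecBound p k L) : Gain p k ((k !) ^ 2) e L := by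
  intro l hl hlk
  have hp1 : (1 : ℝ) ≤ p := by exact_mod_cast hp.one_le
  obtain ⟨C, hC, hdec⟩ := hL
  refine ⟨C, by linarith, fun H b a _ hbH hab => ?_⟩
  have hkQ : k ≤ (k !) ^ 2 :=
    (Nat.self_le_factorial k).trans (Nat.le_self_pow two_ne_zero _)
  have hkb : k * b ≤ H := (Nat.mul_le_mul_right b hkQ).trans hbH
  have hbH' : b ≤ H := (Nat.le_mul_of_pos_left b hk).trans hkb
  have haH : a ≤ H := (scale_le hl hab.le hlk.le).trans hkb
  have key : ∀ c, C * (p : ℝ) ^ (L * ((H - c : ℕ) : ℝ)) ≤ C * (p : ℝ) ^ (L * H) := by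
    intro c
    refine mul_le_mul_of_nonneg_left (Real.rpow_le_rpow_of_exponent_le hp1 ?_) (by linarith)
    refine mul_le_mul_of_nonneg_left ?_ hL0
    exact_mod_cast Nat.sub_le H c
  have h1 : Bil p k (crit k) 0 a b H (C * (p : ℝ) ^ (L * H)) :=
    ((Bil.of_dec hp.pos hk haH (by positivity) (hdec (H - a))).mono (key a)).symm
  have h2 : Bil p k 0 (crit k) a b H (C * (p : ℝ) ^ (L * H)) :=
    (Bil.of_dec hp.pos hk hbH' (by positivity) (hdec (H - b))).mono (key b)
  have hck := crit_pos hk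
  have hθ1 : crit l / crit k < 1 := (div_lt_one hck).2 (crit_lt hlk)
  have hθ0 : 0 < crit l / crit k := div_pos (crit_pos hl) hck
  have hB : 0 ≤ C * (p : ℝ) ^ (L * H) := by positivity
  have h3 := Bil.interpolate h1 h2 hθ0 hθ1 hck.le le_rfl le_rfl hck.le hB hB
    (x := crit l) (y := crit k - crit l) (by field_simp; ring) (by field_simp; ring)
  refine h3.mono (le_of_eq ?_)
  rw [← Real.rpow_add_of_nonneg hB hθ0.le (by linarith), add_sub_cancel, Real.rpow_one, he l hl,
    zero_mul, sub_zero]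

/-- One step of the iteration for the gains. -/
lemma Gain.step {p k Q : ℕ} {e : ℕ → ℝ} {L ε : ℝ} (hp : p.Prime) (hkp : k < p) (hk : 1 ≤ k)
    (hQ : (k !) ^ 2 ∣ Q) (hQ0 : 0 < Q) (hε : 0 < ε) (he0 : e 0 ≤ L)
    (hlow : ∀ l, 1 ≤ l → l < k → ∀ δ : ℝ, 0 < δ → DecBound p l δ) (hL : DecBound p k L)
    (h : Gain p k Q e L) {e' : ℕ → ℝ}
    (he' : ∀ l, 1 ≤ l → l < k →
      e' l = e (k - l) / l + e (l - 1) * ((k - l) / (k - l + 1)) - 2 * ε) :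
    Gain p k (Q * k !) e' L := by
  intro l hl hlk
  have hp1 : (1 : ℝ) ≤ p := by exact_mod_cast hp.one_le
  have hp0 : (0 : ℝ) < p := by exact_mod_cast hp.pos
  obtain ⟨C₁, hC₁, h₁⟩ := h.coarsen hp hkp hk hQ hQ0 hε he0 hlow hL (l := k - l) (by omega)
  obtain ⟨C₂, hC₂, h₂⟩ := h.coarsen hp hkp hk hQ hQ0 hε he0 hlow hL (l := l - 1) (by omega)
  have hlr : (1 : ℝ) ≤ l := by exact_mod_cast hl
  have hlkr : (l : ℝ) < k := by exact_mod_cast hlk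
  set θ : ℝ := 1 / (k - l + 1) with hθ
  have hD : (1 : ℝ) < k - l + 1 := by linarith
  have hθ0 : 0 < θ := by rw [hθ]; positivity
  have hθ1 : θ < 1 := by rw [hθ, div_lt_one (by linarith)]; exact hD
  refine ⟨C₁ ^ θ * C₂ ^ (1 - θ), by positivity, fun H b a hQb hbH hab => ?_⟩
  have hak : a ≤ k * b := scale_le hl hab.le hlk.le
  have hkf : k ≤ k ! := Nat.self_le_factorial k
  have hQa : Q ∣ a := by
    obtain ⟨n, rfl⟩ := hQb
    obtain ⟨f, hf⟩ := Nat.dvd_factorial hl hlk.le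
    refine ⟨(k - l + 1) * f * n, Nat.eq_of_mul_eq_mul_left hl ?_⟩
    rw [hab, hf]
    ring
  have hQaH : Q * a ≤ H := by
    calc Q * a ≤ Q * (k * b) := Nat.mul_le_mul_left Q hak
      _ ≤ Q * (k ! * b) := Nat.mul_le_mul_left Q (Nat.mul_le_mul_right b hkf)
      _ = Q * k ! * b := by ring
      _ ≤ H := hbH
  have hQb' : Q ∣ b := (Dvd.intro _ rfl).trans hQb
  have hQbH : Q * b ≤ H :=
    (Nat.mul_le_mul_right b (Nat.le_mul_of_pos_right Q (Nat.factorial_pos k))).trans hbH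
  obtain ⟨n, rfl⟩ := Nat.exists_eq_add_of_lt hlk
  have hbla : b ≤ l * a := by
    rw [hab]
    exact Nat.le_mul_of_pos_left b (by omega)
  have s1 := (h₁ H a b hQa hQaH hak (by
    have e1 : l + n + 1 - l = n + 1 := by omega
    have e2 : l + n + 1 - (n + 1) + 1 = l + 1 := by omega
    rw [e1] at hab ⊢
    rw [e2]
    nlinarith)).symm
  have s2 := h₂ H b a hQb' hQbH (hbla.trans (Nat.mul_le_mul_right a hlk.le)) (by
    obtain ⟨l, rfl⟩ := Nat.exists_eq_add_of_le' hl
    have e1 : l + 1 + n + 1 - (l + 1 - 1) + 1 = n + 3 := by omega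
    have e2 : l + 1 + n + 1 - (l + 1) + 1 = n + 2 := by omega
    rw [e2] at hab
    rw [e1, Nat.add_sub_cancel]
    nlinarith)
  have hsub : ((l + n + 1 - l : ℕ) : ℝ) = n + 1 := by
    have : l + n + 1 - l = n + 1 := by omega
    rw [this]
    push_cast
    ring
  have hsub' : ((l - 1 : ℕ) : ℝ) = l - 1 := by
    rw [Nat.cast_sub hl]
    simp
  have hθn : θ = 1 / (n + 2) := by
    rw [hθ]
    push_cast
    ring_nf
  have hn2 : (n : ℝ) + 2 ≠ 0 := by positivity
  have s3 := Bil.interpolate s1 s2 hθ0 hθ1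
    (sub_nonneg.2 (crit_lt (show l + n + 1 - l < l + n + 1 by omega)).le) (crit_nonneg _)
    (crit_nonneg _) (sub_nonneg.2 (crit_lt (show l - 1 < l + n + 1 by omega)).le)
    (by positivity) (by positivity) (x := crit l) (y := crit (l + n + 1) - crit l)
    (by
      simp only [crit, hsub, hsub', hθn]
      push_cast
      field_simp
      ring)
    (by
      simp only [crit, hsub, hsub', hθn]
      push_cast
      field_simp
      ring)
  refine s3.mono ?_
  rw [Real.mul_rpow hC₁ (by positivity), Real.mul_rpow hC₂ (by positivity), mul_mul_mul_comm,
    ← Real.rpow_mul hp0.le, ← Real.rpow_mul hp0.le, ← Real.rpow_add hp0]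
  refine mul_le_mul_of_nonneg_left (Real.rpow_le_rpow_of_exponent_le hp1 ?_) (by positivity)
  have ha : (a : ℝ) = (n + 2) / l * b := by
    have e2 : l + n + 1 - l + 1 = n + 2 := by omega
    rw [e2] at hab
    have : (l : ℝ) * a = (n + 2) * b := by exact_mod_cast hab
    field_simp
    linarith
  rw [he' l hl hlk, hθn, ha]
  have hb0 : (0 : ℝ) ≤ b := Nat.cast_nonneg b
  push_cast
  have g1 : ε * b / l ≤ ε * b := div_le_self (by positivity) hlr
  have g2 : ε * b * ((n + 1) / (n + 2)) ≤ ε * b :=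
    mul_le_of_le_one_right (by positivity) ((div_le_one (by positivity)).2 (by linarith))
  have hl0 : (l : ℝ) ≠ 0 := by positivity
  have g3 : (L * H - e (l + n + 1 - l) * ((n + 2) / l * b) + ε * ((n + 2) / l * b)) *
        (1 / ((n : ℝ) + 2)) +
      (L * H - e (l - 1) * b + ε * b) * (1 - 1 / ((n : ℝ) + 2)) =
      L * H - (e (l + n + 1 - l) / l + e (l - 1) * ((n + 1) / (n + 2))) * b +
        (ε * b / l + ε * b * ((n + 1) / (n + 2))) := by
    field_simp
    ring
  rw [g3]
  have g4 : ((l : ℝ) + n + 1 - l) / (l + n + 1 - l + 1) = (n + 1) / (n + 2) := by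
    congr 1 <;> ring
  rw [g4]
  linarith

end

section

open scoped Nat

/-- The gain recursion. -/
noncomputable def nextGain (k : ℕ) (L₀ ε : ℝ) (e : ℕ → ℝ) (l : ℕ) : ℝ :=
  if l = 0 then L₀ else e (k - l) / l + e (l - 1) * ((k - l) / (k - l + 1)) - 2 * ε

/-- The total gain increases by a fixed amount at each step. -/
lemma sum_nextGain {n : ℕ} {L₀ ε : ℝ} {e : ℕ → ℝ} (he : e 0 = L₀) :
    ∑ l ∈ Finset.range n, nextGain (n + 1) L₀ ε e (l + 1) =
      ∑ l ∈ Finset.range n, e (l + 1) + n * (L₀ / (n + 1) - 2 * ε) := by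
  have h1 : ∑ l ∈ Finset.range n, e (n + 1 - (l + 1)) / ((l + 1 : ℕ) : ℝ) =
      ∑ l ∈ Finset.range n, e (l + 1) / ((n - l : ℕ) : ℝ) := by
    rw [← Finset.sum_range_reflect]
    refine Finset.sum_congr rfl fun l hl => ?_
    have hl := Finset.mem_range.1 hl
    have e1 : n + 1 - (n - 1 - l + 1) = l + 1 := by omega
    have e2 : n - 1 - l + 1 = n - l := by omega
    rw [e1, e2]
  have h2 : ∑ l ∈ Finset.range n, e l * (((n : ℝ) - l) / (n - l + 1)) =
      ∑ l ∈ Finset.range n, e (l + 1) * (((n : ℝ) - (l + 1 : ℕ)) / (n - (l + 1 : ℕ) + 1)) +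
        L₀ * (n / (n + 1)) := by
    have := Finset.sum_range_succ' (fun l => e l * (((n : ℝ) - l) / (n - l + 1))) n
    rw [Finset.sum_range_succ] at this
    simpa [he] using this
  have h3 : ∀ l ∈ Finset.range n, nextGain (n + 1) L₀ ε e (l + 1) =
      e (n + 1 - (l + 1)) / ((l + 1 : ℕ) : ℝ) + e l * (((n : ℝ) - l) / (n - l + 1)) - 2 * ε := by
    intro l _
    rw [nextGain, if_neg (Nat.succ_ne_zero l), Nat.add_sub_cancel]
    push_cast
    ring_nf
  rw [Finset.sum_congr rfl h3, Finset.sum_sub_distrib, Finset.sum_add_distrib, h1, h2,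
    ← add_assoc, ← Finset.sum_add_distrib, Finset.sum_const, Finset.card_range, nsmul_eq_mul]
  have h4 : ∀ l ∈ Finset.range n, e (l + 1) / ((n - l : ℕ) : ℝ) +
      e (l + 1) * (((n : ℝ) - (l + 1 : ℕ)) / (n - (l + 1 : ℕ) + 1)) = e (l + 1) := by
    intro l hl
    have hl := Finset.mem_range.1 hl
    have hlr : (l : ℝ) < n := by exact_mod_cast hl
    have hne : (n : ℝ) - l ≠ 0 := by linarith
    rw [Nat.cast_sub hl.le]
    push_cast
    have : (n : ℝ) - (l + 1) + 1 = n - l := by ring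
    rw [this]
    field_simp
    ring
  rw [Finset.sum_congr rfl h4]
  have : (n : ℝ) + 1 ≠ 0 := by positivity
  field_simp
  ring

/-- The gains produced by iteration, together with their sum. -/
lemma exists_gain {p k : ℕ} {L L₀ : ℝ} (hp : p.Prime) (hkp : k < p) (hk : 1 ≤ k) (hL₀ : 0 < L₀)
    (hLL : L₀ ≤ L) (hlow : ∀ l, 1 ≤ l → l < k → ∀ δ : ℝ, 0 < δ → DecBound p l δ)
    (hL : DecBound p k L) (n : ℕ) :
    ∃ e : ℕ → ℝ, e 0 = L₀ ∧ Gain p k ((k !) ^ 2 * k ! ^ n) e L ∧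
      ∑ l ∈ Finset.range (k - 1), e (l + 1) = n * ((k - 1 : ℕ) * (L₀ / (2 * k))) := by
  have hk0 : (0 : ℝ) < k := by exact_mod_cast hk
  induction n with
  | zero =>
    refine ⟨fun l => if l = 0 then L₀ else 0, by simp, ?_, by simp⟩
    rw [pow_zero, mul_one]
    exact Gain.initial hp hk (by linarith) (fun l hl => if_neg (by omega)) hL
  | succ n ih =>
    obtain ⟨e, he, hg, hsum⟩ := ih
    have hε : 0 < L₀ / (4 * k) := by positivity
    refine ⟨nextGain k L₀ (L₀ / (4 * k)) e, if_pos rfl, ?_, ?_⟩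
    · rw [pow_succ (k !) n, ← mul_assoc]
      exact hg.step hp hkp hk (Dvd.intro _ rfl) (by positivity) hε (he.trans_le hLL) hlow hL
        fun l hl _ => if_neg (by omega)
    · obtain ⟨m, rfl⟩ := Nat.exists_eq_add_of_le' hk
      rw [Nat.add_sub_cancel] at hsum ⊢
      rw [sum_nextGain he, hsum]
      have : (m : ℝ) + 1 ≠ 0 := by positivity
      push_cast
      field_simp
      ring

/-- The bilinear constants improve on the linear ones by a fixed power. -/
lemma exists_bilinear_saving {p k : ℕ} {L₀ : ℝ} (hp : p.Prime) (hkp : k < p) (hk : 2 ≤ k)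
    (hL₀ : 0 < L₀) (hlow : ∀ l, 1 ≤ l → l < k → ∀ δ : ℝ, 0 < δ → DecBound p l δ) :
    ∃ c : ℝ, 0 < c ∧ ∀ L, L₀ ≤ L → DecBound p k L → ∃ C : ℝ, 0 ≤ C ∧ ∀ H : ℕ,
      Bil p k (crit k / 2) (crit k / 2) 0 0 H (C * (p : ℝ) ^ ((L - c) * H)) := by
  have hp1 : (1 : ℝ) ≤ p := by exact_mod_cast hp.one_le
  have hp0 : (0 : ℝ) < p := by exact_mod_cast hp.pos
  have hk1 : 1 ≤ k := by omega
  have hk0 : (0 : ℝ) < k := by exact_mod_cast hk1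
  set G : ℝ := k * (crit k + 2) + 1 with hG
  obtain ⟨n, hn⟩ := exists_nat_ge (G / (L₀ / (2 * k)))
  rw [div_le_iff₀ (by positivity)] at hn
  set Q : ℕ := (k !) ^ 2 * k ! ^ n with hQ
  have hQ0 : 0 < Q := by positivity
  have hQr : (0 : ℝ) < Q := by exact_mod_cast hQ0
  refine ⟨1 / Q, by positivity, fun L hLL hL => ?_⟩
  obtain ⟨e, he, hg, hsum⟩ := exists_gain hp hkp hk1 hL₀ hLL hlow hL n
  have hex : ∃ l ∈ Finset.range (k - 1), G ≤ e (l + 1) := by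
    refine Finset.exists_le_of_sum_le ⟨0, Finset.mem_range.2 (by omega)⟩ ?_
    rw [hsum, Finset.sum_const, Finset.card_range, nsmul_eq_mul, mul_left_comm]
    exact mul_le_mul_of_nonneg_left hn (Nat.cast_nonneg _)
  obtain ⟨l, hlk, hGl⟩ := hex
  have hlk' := Finset.mem_range.1 hlk
  have hl1 : l + 1 < k := by omega
  obtain ⟨C, hC, hB⟩ := hg (l + 1) (by omega) hl1
  refine ⟨C * (p : ℝ) ^ (Q : ℝ), by positivity, fun H => ?_⟩
  set b := Q * (H / Q ^ 2) with hb
  have hQb : Q ∣ b := Dvd.intro _ rfl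
  have hQbH : Q * b ≤ H := by
    rw [hb, ← mul_assoc, ← sq]
    exact Nat.mul_div_le H (Q ^ 2)
  have hkQ : k ≤ Q := by
    refine (Nat.self_le_factorial k).trans ?_
    refine (Nat.le_self_pow two_ne_zero _).trans ?_
    exact Nat.le_mul_of_pos_right _ (by positivity)
  obtain ⟨a, ha⟩ : l + 1 ∣ (k - (l + 1) + 1) * b := by
    refine Dvd.dvd.mul_left (Dvd.dvd.trans ?_ hQb) _
    refine (Nat.dvd_factorial (Nat.succ_pos l) hl1.le).trans ?_
    exact (dvd_pow_self _ two_ne_zero).trans (Dvd.intro _ rfl)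
  have hak := scale_le (Nat.succ_pos l) ha.ge hl1.le
  have haH : a ≤ H := hak.trans ((Nat.mul_le_mul_right b hkQ).trans hQbH)
  have hbH : b ≤ H := (Nat.le_mul_of_pos_left b hQ0).trans hQbH
  have hx : 0 < crit (l + 1) := crit_pos (Nat.succ_pos l)
  have hy : 0 < crit k - crit (l + 1) := sub_pos.2 (crit_lt hl1)
  have s1 := Bil.shrink hp.pos hx hy haH hbH (by positivity) (hB H b a hQb hQbH ha.symm)
  have hbr : (0 : ℝ) ≤ b := Nat.cast_nonneg b
  have hakr : (a : ℝ) ≤ k * b := by exact_mod_cast hak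
  have hbk : (b : ℝ) ≤ k * b := by
    have : (1 : ℝ) ≤ k := by exact_mod_cast hk1
    nlinarith
  have hbQ : (H : ℝ) / Q - Q ≤ b := by
    have h1 : H < Q ^ 2 * (H / Q ^ 2 + 1) := by
      have h2 := Nat.div_add_mod H (Q ^ 2)
      have h3 := Nat.mod_lt H (show 0 < Q ^ 2 by positivity)
      rw [mul_add, mul_one]
      omega
    have h4 : (H : ℝ) ≤ Q * b + Q ^ 2 := by
      have : H ≤ Q * b + Q ^ 2 := by
        rw [hb]
        nlinarith
      exact_mod_cast this
    rw [sub_le_iff_le_add, div_le_iff₀ hQr]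
    nlinarith
  have s2 : Bil p k (crit (l + 1)) (crit k - crit (l + 1)) 0 0 H
      (C * (p : ℝ) ^ (Q : ℝ) * (p : ℝ) ^ ((L - 1 / Q) * H)) := by
    refine s1.mono ?_
    have e1 : ((p ^ a : ℕ) : ℝ) ^ crit (l + 1) * ((p ^ b : ℕ) : ℝ) ^ (crit k - crit (l + 1)) *
        (((p ^ a : ℕ) : ℝ) * ((p ^ b : ℕ) : ℝ)) *
          (C * (p : ℝ) ^ (L * H - e (l + 1) * b)) =
        C * (p : ℝ) ^ (a * crit (l + 1) + b * (crit k - crit (l + 1)) + (a + b) +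
          (L * H - e (l + 1) * b)) := by
      push_cast
      rw [Real.rpow_add hp0, Real.rpow_add hp0, Real.rpow_add hp0, Real.rpow_add hp0,
        Real.rpow_mul hp0.le, Real.rpow_mul hp0.le, Real.rpow_natCast, Real.rpow_natCast]
      ring
    rw [e1, mul_assoc C, ← Real.rpow_add hp0]
    refine mul_le_mul_of_nonneg_left (Real.rpow_le_rpow_of_exponent_le hp1 ?_) hC
    have i1 : a * crit (l + 1) ≤ k * b * crit (l + 1) := mul_le_mul_of_nonneg_right hakr hx.le
    have i2 : b * (crit k - crit (l + 1)) ≤ k * b * (crit k - crit (l + 1)) :=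
      mul_le_mul_of_nonneg_right hbk hy.le
    have i3 : G * b ≤ e (l + 1) * b := mul_le_mul_of_nonneg_right hGl hbr
    have i4 : G * b = k * b * crit (l + 1) + k * b * (crit k - crit (l + 1)) + 2 * (k * b) + b := by
      rw [hG]
      ring
    have i5 : (L - 1 / Q) * H = L * H - H / Q := by ring
    rw [i5]
    linarith
  have hB0 : 0 ≤ C * (p : ℝ) ^ (Q : ℝ) * (p : ℝ) ^ ((L - 1 / Q) * H) := by positivity
  have s3 := Bil.interpolate s2 s2.symm (θ := 1 / 2) (by norm_num) (by norm_num) hx.le hy.le hy.le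
    hx.le hB0 hB0 (x := crit k / 2) (y := crit k / 2) (by ring) (by ring)
  refine s3.mono (le_of_eq ?_)
  rw [← Real.rpow_add_of_nonneg hB0 (by norm_num) (by norm_num)]
  norm_num

/-- A power saving in the bilinear constants passes to the linear ones. -/
lemma DecBound.of_bil {p k : ℕ} {L C : ℝ} (hp : p.Prime) (hk : 1 ≤ k) (hL : 0 < L) (hC : 0 ≤ C)
    (h : ∀ H : ℕ, Bil p k (crit k / 2) (crit k / 2) 0 0 H (C * (p : ℝ) ^ (L * H))) :
    DecBound p k L := by
  have hp1 : (1 : ℝ) < p := by exact_mod_cast hp.one_lt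
  have hp0 : (0 : ℝ) < p := by linarith
  have hs1 := crit_div_two_one_le hk
  set s := crit k / 2 with hs
  have hs0 : 0 < s := by linarith
  have hr : (p : ℝ) ^ (-(L / s)) < 1 :=
    Real.rpow_lt_one_of_one_lt_of_neg hp1 (neg_lt_zero.2 (by positivity))
  set r := (p : ℝ) ^ (-(L / s)) with hrdef
  set D : ℝ := max 1 (p ^ 2 * C ^ (1 / s) / (1 - r)) with hD
  have hD1 : 1 ≤ D := le_max_left _ _
  have hD2 : p ^ 2 * C ^ (1 / s) ≤ D * (1 - r) := by
    rw [← div_le_iff₀ (by linarith)]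
    exact le_max_right _ _
  have hpow : ∀ x : ℝ, ((p : ℝ) ^ (L * x)) ^ (1 / s) = (p : ℝ) ^ (L / s * x) := by
    intro x
    rw [← Real.rpow_mul hp0.le]
    congr 1
    field_simp
  refine ⟨D ^ s, Real.one_le_rpow hD1 hs0.le, fun H => ?_⟩
  induction H with
  | zero =>
    refine (Dec.zero p hk).mono ?_
    simpa using Real.one_le_rpow hD1 hs0.le
  | succ H ih =>
    have h1 := Dec.of_bil hp.pos hk (Nat.succ_pos H) (by positivity) (by positivity) ih (h (H + 1))
    refine h1.mono ?_
    rw [← hs]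
    have e1 : D ^ s * (p : ℝ) ^ (L * (H + 1 : ℕ)) = (D * (p : ℝ) ^ (L / s * (H + 1 : ℕ))) ^ s := by
      rw [Real.mul_rpow (by positivity) (by positivity), ← hpow, one_div,
        Real.rpow_inv_rpow (by positivity) hs0.ne']
    rw [e1]
    refine Real.rpow_le_rpow (by positivity) ?_ hs0.le
    rw [Real.mul_rpow (by positivity) (by positivity), Real.mul_rpow hC (by positivity), hpow, hpow,
      one_div, Real.rpow_rpow_inv (by positivity) hs0.ne', ← one_div]
    have e2 : (p : ℝ) ^ (L / s * H) = r * (p : ℝ) ^ (L / s * (H + 1 : ℕ)) := by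
      rw [hrdef, ← Real.rpow_add hp0]
      congr 1
      push_cast
      ring
    rw [e2]
    have hP : 0 ≤ (p : ℝ) ^ (L / s * (H + 1 : ℕ)) := by positivity
    nlinarith

/-- The decoupling constants at the critical exponent grow subpolynomially. -/
theorem decBound {p : ℕ} (hp : p.Prime) : ∀ k, 1 ≤ k → k < p → ∀ L : ℝ, 0 < L →
    DecBound p k L := by
  intro k
  induction k using Nat.strong_induction_on with
  | _ k ih =>
    intro hk hkp L₀ hL₀
    have hp1 : (1 : ℝ) ≤ p := by exact_mod_cast hp.one_le
    rcases Nat.eq_or_lt_of_le hk with rfl | hk2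
    · refine ⟨1, le_rfl, fun H => (Dec.one hp.pos H).mono ?_⟩
      rw [one_mul]
      exact Real.one_le_rpow hp1 (by positivity)
    · obtain ⟨c, hc, hsave⟩ := exists_bilinear_saving hp hkp hk2 hL₀
        fun l hl hlk δ hδ => ih l hlk hl (by omega) δ hδ
      have hit : ∀ n : ℕ, DecBound p k (max L₀ (crit k - n * c)) := by
        intro n
        induction n with
        | zero =>
          refine ⟨1, le_rfl, fun H => (Dec.trivial hp.pos hk H).mono ?_⟩
          rw [one_mul]
          refine Real.rpow_le_rpow_of_exponent_le hp1 ?_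
          refine mul_le_mul_of_nonneg_right ?_ (Nat.cast_nonneg H)
          simp
        | succ n hn =>
          obtain ⟨C, hC, hB⟩ := hsave _ (le_max_left _ _) hn
          refine DecBound.of_bil hp hk (lt_max_of_lt_left hL₀) hC fun H => (hB H).mono ?_
          refine mul_le_mul_of_nonneg_left (Real.rpow_le_rpow_of_exponent_le hp1 ?_) hC
          refine mul_le_mul_of_nonneg_right ?_ (Nat.cast_nonneg H)
          rw [sub_le_iff_le_add]
          have h1 := le_max_left L₀ (crit k - (n + 1 : ℕ) * c)
          have h2 := le_max_right L₀ (crit k - (n + 1 : ℕ) * c)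
          refine max_le (by linarith) ?_
          push_cast at h2 ⊢
          linarith
      obtain ⟨n, hn⟩ := exists_nat_ge (crit k / c)
      rw [div_le_iff₀ hc] at hn
      have := hit n
      rwa [max_eq_left (by linarith)] at this

end

section

open Polynomial

open scoped Classical in
lemma card_cls_le_card {ι : Type} (ν : ι → ℤ) (q : ℕ) (S : Finset ι) : (cls ν q S).card ≤ S.card :=
  Finset.card_image_le

/-- The Vinogradov exponential sum. -/
noncomputable def vsum (k N : ℕ) (x : Fin k → ℝ) : ℂ :=
  ∑ a ∈ Finset.Icc 1 N, ee (∑ j : Fin k, (a : ℝ) ^ ((j : ℕ) + 1) * x j)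

lemma continuous_vsum (k N : ℕ) : Continuous (vsum k N) := by
  unfold vsum ee
  fun_prop

lemma norm_vsum_le (k N : ℕ) (x : Fin k → ℝ) : ‖vsum k N x‖ ≤ N := by
  refine (norm_sum_le _ _).trans ?_
  simp [norm_ee]

lemma vsum_add_int (k N : ℕ) (x : Fin k → ℝ) (z : Fin k → ℤ) :
    vsum k N (fun j => x j + z j) = vsum k N x := by
  refine Finset.sum_congr rfl fun a _ => ?_
  have : ∑ j : Fin k, (a : ℝ) ^ ((j : ℕ) + 1) * (x j + z j) =
      ∑ j : Fin k, (a : ℝ) ^ ((j : ℕ) + 1) * x j +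
        ((∑ j : Fin k, (a : ℤ) ^ ((j : ℕ) + 1) * z j : ℤ) : ℝ) := by
    push_cast
    rw [← Finset.sum_add_distrib]
    exact Finset.sum_congr rfl fun j _ => by ring
  rw [this, ee_add_int]

/-- Integrals of periodic functions over the unit cube are translation invariant. -/
lemma setIntegral_add_of_periodic {k : ℕ} {f : (Fin k → ℝ) → ℝ}
    (hf : ∀ (x : Fin k → ℝ) (z : Fin k → ℤ), f (fun j => x j + z j) = f x) (y : Fin k → ℝ) :
    ∫ x in Set.Icc (0 : Fin k → ℝ) 1, f (x + y) = ∫ x in Set.Icc (0 : Fin k → ℝ) 1, f x := by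
  set b := Pi.basisFun ℝ (Fin k) with hb
  set D := ZSpan.fundamentalDomain b with hD
  have hDpi : D = Set.univ.pi fun _ => Set.Ico (0 : ℝ) 1 := by
    ext x
    simp [hD, hb, ZSpan.mem_fundamentalDomain]
  have hIcc : Set.Icc (0 : Fin k → ℝ) 1 =ᵐ[volume] D := by
    rw [hDpi]
    exact (Measure.univ_pi_Ico_ae_eq_Icc (f := (0 : Fin k → ℝ)) (g := 1)).symm
  have hfund : IsAddFundamentalDomain (Submodule.span ℤ (Set.range b)) D :=
    ZSpan.isAddFundamentalDomain b volume
  have hinv : ∀ (g : Submodule.span ℤ (Set.range b)) (x : Fin k → ℝ), f (g +ᵥ x) = f x := by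
    intro g x
    obtain ⟨z, hz⟩ : ∃ z : Fin k → ℤ, (g : Fin k → ℝ) = fun j => (z j : ℝ) := by
      have := (b.mem_span_iff_repr_mem ℤ (g : Fin k → ℝ)).1 g.2
      choose z hz using this
      exact ⟨z, funext fun j => by simpa [hb] using (hz j).symm⟩
    rw [← hf x z]
    congr 1
    funext j
    rw [Submodule.vadd_def, hz, vadd_eq_add, Pi.add_apply, add_comm]
  rw [setIntegral_congr_set hIcc, setIntegral_congr_set hIcc]
  have : VAddInvariantMeasure (Submodule.span ℤ (Set.range b)) (Fin k → ℝ) volume :=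
    ⟨fun c s _ => measure_preimage_add volume (c : Fin k → ℝ) s⟩
  have htrans := hfund.vadd_of_comm y
  rw [← htrans.setIntegral_eq hfund hinv]
  have := (measurePreserving_add_left volume y).setIntegral_image_emb
    (measurableEmbedding_addLeft y) f D
  simp only [add_comm _ y]
  exact this.symm

/-- The sum of the Vinogradov exponential sum over a grid of translates. -/
lemma sum_grid_le {p k H N : ℕ} {A : ℝ} (hk : 1 ≤ k) (hN : N ≤ p ^ H)
    (hA0 : 0 ≤ A)
    (hA : Dec p k H A) [NeZero (p ^ (k * H))] (x : Fin k → ℝ) :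
    ∑ c : Fin (k + 1) → ZMod (p ^ (k * H)),
      ‖vsum k N (fun j => x j + ((c j.succ).val : ℝ) / (p ^ (k * H) : ℕ))‖ ^ crit k ≤
      A * (N : ℝ) ^ (crit k / 2) * Fintype.card (Fin (k + 1) → ZMod (p ^ (k * H))) := by
  classical
  set q := p ^ (k * H) with hq
  have hq0 : q ≠ 0 := NeZero.ne q
  have hqr : (q : ℝ) ≠ 0 := by exact_mod_cast hq0
  set Ω := Fin (k + 1) → ZMod q with hΩ
  set u : ℕ → Ω → ℂ := fun a c => ee (∑ j : Fin k, (a : ℝ) ^ ((j : ℕ) + 1) * x j) *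
    ee (((∑ j : Fin (k + 1), ((c j).val : ℤ) * (a : ℤ) ^ (j : ℕ) : ℤ) : ℝ) / q) with hu
  set S := Finset.Icc 1 N with hS
  have hs : PhaseSystem p k (k * H) (fun _ : Ω => (1 : ℝ)) u (fun a : ℕ => (a : ℤ)) S := by
    refine ⟨fun _ => zero_le_one, fun P hP => ?_⟩
    refine ⟨Equiv.addRight fun j => ((P.coeff j : ℤ) : ZMod q), fun _ => rfl, fun a _ c => ?_⟩
    simp only [hu, Equiv.coe_addRight]
    rw [mul_left_comm]
    congr 1
    rw [← ee_add, ← add_div, ← Int.cast_add]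
    refine ee_div_congr hq0 ?_
    rw [← ZMod.intCast_eq_intCast_iff_dvd_sub]
    rw [eval_eq_sum_range' (Nat.lt_succ_of_le hP), Finset.sum_range]
    push_cast
    simp only [ZMod.natCast_val, ZMod.cast_id', id]
    rw [← Finset.sum_add_distrib]
    refine Finset.sum_congr rfl fun j _ => ?_
    rw [Pi.add_apply]
    ring
  have hnorm : ∀ c : Ω, ‖fsum u S c‖ =
      ‖vsum k N (fun j => x j + ((c j.succ).val : ℝ) / q)‖ := by
    intro c
    have : fsum u S c = ee (((c 0).val : ℝ) / q) *
        vsum k N (fun j => x j + ((c j.succ).val : ℝ) / q) := by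
      rw [fsum, vsum, Finset.mul_sum]
      refine Finset.sum_congr rfl fun a _ => ?_
      simp only [hu]
      rw [← ee_add, ← ee_add]
      congr 1
      rw [Fin.sum_univ_succ]
      push_cast
      rw [add_div, Finset.sum_div, add_left_comm, ← Finset.sum_add_distrib]
      congr 1
      · simp
      · refine Finset.sum_congr rfl fun j _ => ?_
        rw [Fin.val_succ]
        ring
    rw [this, norm_mul, norm_ee, one_mul]
  have hmom : ∀ a, moment (fun _ : Ω => (1 : ℝ)) u (crit k) {a} = Fintype.card Ω := by
    intro a
    simp [moment, fsum, hu, norm_ee]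
  have hcls : ∀ J ∈ cls (fun a : ℕ => (a : ℤ)) (p ^ H) S,
      moment (fun _ : Ω => (1 : ℝ)) u (crit k) J = Fintype.card Ω := by
    intro J hJ
    obtain ⟨a, ha⟩ := nonempty_of_mem_cls hJ
    have : J = {a} := by
      refine Finset.eq_singleton_iff_unique_mem.2 ⟨ha, fun b hb => ?_⟩
      have h1 := Finset.mem_Icc.1 (subset_of_mem_cls hJ ha)
      have h2 := Finset.mem_Icc.1 (subset_of_mem_cls hJ hb)
      have h3 := dvd_of_mem_cls hJ hb ha
      have h4 : (b : ℤ) - a = 0 := by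
        refine Int.eq_zero_of_abs_lt_dvd h3 ?_
        rw [abs_lt]
        omega
      omega
    rw [this, hmom]
  have hcard : ((cls (fun a : ℕ => (a : ℤ)) (p ^ H) S).card : ℝ) ≤ N := by
    have : (cls (fun a : ℕ => (a : ℤ)) (p ^ H) S).card ≤ S.card := card_cls_le_card _ _ _
    rw [hS, Nat.card_Icc, Nat.add_sub_cancel] at this
    exact_mod_cast this
  have hc : 0 < crit k := crit_pos hk
  have hc2 : crit k / 2 ≠ 0 := by positivity
  have hsq : sqSum k (fun _ : Ω => (1 : ℝ)) u (fun a : ℕ => (a : ℤ)) (p ^ H) S ≤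
      N * (Fintype.card Ω : ℝ) ^ (1 / (crit k / 2)) := by
    rw [sqSum, Finset.sum_congr rfl fun J hJ => by rw [hcls J hJ], Finset.sum_const, nsmul_eq_mul]
    gcongr
  have hmain := hA Ω ℕ _ u _ S hs
  rw [moment] at hmain
  simp only [one_mul, hnorm] at hmain
  refine hmain.trans ?_
  rw [mul_assoc]
  refine mul_le_mul_of_nonneg_left ?_ hA0
  refine (Real.rpow_le_rpow (sqSum_nonneg hs.1) hsq (by positivity)).trans_eq ?_
  rw [Real.mul_rpow (by positivity) (by positivity), ← Real.rpow_mul (by positivity),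
    one_div_mul_cancel hc2, Real.rpow_one]

end

section

lemma volume_Icc_unit (k : ℕ) : volume (Set.Icc (0 : Fin k → ℝ) 1) = 1 := by
  simp [Real.volume_Icc_pi]

lemma integrableOn_unit {k : ℕ} {f : (Fin k → ℝ) → ℝ} (hf : Continuous f) :
    IntegrableOn f (Set.Icc (0 : Fin k → ℝ) 1) :=
  hf.continuousOn.integrableOn_compact isCompact_Icc

lemma setIntegral_unit_const (k : ℕ) (c : ℝ) :
    ∫ _ in Set.Icc (0 : Fin k → ℝ) 1, c = c := by
  simp [Measure.real, volume_Icc_unit]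

lemma continuous_norm_vsum_rpow (k N : ℕ) {r : ℝ} (hr : 0 ≤ r) :
    Continuous fun x => ‖vsum k N x‖ ^ r :=
  (continuous_vsum k N).norm.rpow_const fun _ => Or.inr hr

/-- A decoupling inequality yields a mean value estimate at the critical exponent. -/
lemma integral_crit_le {p k H N : ℕ} {A : ℝ} (hp : p.Prime) (hk : 1 ≤ k) (hN : N ≤ p ^ H)
    (hA0 : 0 ≤ A) (hA : Dec p k H A) :
    ∫ x in Set.Icc (0 : Fin k → ℝ) 1, ‖vsum k N x‖ ^ crit k ≤ A * (N : ℝ) ^ (crit k / 2) := by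
  have : NeZero (p ^ (k * H)) := ⟨pow_ne_zero _ hp.ne_zero⟩
  set G := Fin (k + 1) → ZMod (p ^ (k * H)) with hG
  have hG0 : (0 : ℝ) < Fintype.card G := by exact_mod_cast Fintype.card_pos
  set y : G → Fin k → ℝ := fun c j => ((c j.succ).val : ℝ) / (p ^ (k * H) : ℕ) with hy
  have hcont := continuous_norm_vsum_rpow k N (crit_nonneg k)
  have hper : ∀ c : G, ∫ x in Set.Icc (0 : Fin k → ℝ) 1, ‖vsum k N (x + y c)‖ ^ crit k =
      ∫ x in Set.Icc (0 : Fin k → ℝ) 1, ‖vsum k N x‖ ^ crit k := fun c =>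
    setIntegral_add_of_periodic (f := fun x => ‖vsum k N x‖ ^ crit k)
      (fun x z => by rw [vsum_add_int]) (y c)
  have hint : ∀ c : G, IntegrableOn (fun x => ‖vsum k N (x + y c)‖ ^ crit k)
      (Set.Icc (0 : Fin k → ℝ) 1) := fun c =>
    integrableOn_unit (hcont.comp (continuous_id.add continuous_const))
  have h1 : ∫ x in Set.Icc (0 : Fin k → ℝ) 1, ∑ c : G, ‖vsum k N (x + y c)‖ ^ crit k ≤
      ∫ _ in Set.Icc (0 : Fin k → ℝ) 1, A * (N : ℝ) ^ (crit k / 2) * Fintype.card G := by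
    refine integral_mono (integrable_finsetSum _ fun c _ => hint c)
      (integrableOn_unit continuous_const) fun x => ?_
    exact sum_grid_le hk hN hA0 hA x
  rw [integral_finsetSum _ fun c _ => hint c, setIntegral_unit_const,
    Finset.sum_congr rfl fun c _ => hper c, Finset.sum_const, nsmul_eq_mul, Finset.card_univ,
    mul_comm] at h1
  exact le_of_mul_le_mul_right h1 hG0

/-- The mean value estimate at the critical exponent. -/
lemma exists_integral_crit_le {k : ℕ} (hk : 1 ≤ k) {ε : ℝ} (hε : 0 < ε) :
    ∃ A : ℝ, 1 ≤ A ∧ ∀ N : ℕ, 1 ≤ N →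
      ∫ x in Set.Icc (0 : Fin k → ℝ) 1, ‖vsum k N x‖ ^ crit k ≤
        A * (N : ℝ) ^ ε * (N : ℝ) ^ (crit k / 2) := by
  obtain ⟨p, hkp, hp⟩ := Nat.exists_infinite_primes (k + 1)
  obtain ⟨C, hC, hdec⟩ := decBound hp k hk hkp ε hε
  have hp1 : (1 : ℝ) ≤ p := by exact_mod_cast hp.one_le
  refine ⟨C * (p : ℝ) ^ ε, one_le_mul_of_one_le_of_one_le hC (Real.one_le_rpow hp1 hε.le),
    fun N hN => ?_⟩
  obtain ⟨H, hH, hH'⟩ : ∃ H, N ≤ p ^ H ∧ p ^ H ≤ p * N := by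
    refine ⟨Nat.clog p N, Nat.le_pow_clog hp.one_lt N, ?_⟩
    rcases hN.eq_or_lt with rfl | hN1
    · simpa using hp.one_le
    · have h1 := Nat.pow_pred_clog_lt_self hp.one_lt hN1
      have h2 : 0 < Nat.clog p N := Nat.clog_pos hp.one_lt hN1
      obtain ⟨m, hm⟩ := Nat.exists_eq_succ_of_ne_zero h2.ne'
      rw [hm, Nat.pred_succ] at h1
      rw [hm, pow_succ, mul_comm]
      exact Nat.mul_le_mul_left _ h1.le
  have hpow : (p : ℝ) ^ (ε * H) ≤ (p : ℝ) ^ ε * (N : ℝ) ^ ε := by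
    rw [mul_comm ε, Real.rpow_mul (by positivity), Real.rpow_natCast,
      ← Real.mul_rpow (by positivity) (by positivity)]
    exact Real.rpow_le_rpow (by positivity) (by exact_mod_cast hH') hε.le
  refine (integral_crit_le hp hk hH (by positivity) (hdec H)).trans ?_
  rw [mul_assoc C ((p : ℝ) ^ ε)]
  refine mul_le_mul_of_nonneg_right ?_ (by positivity)
  exact mul_le_mul_of_nonneg_left hpow (by positivity)

lemma two_le_crit {k : ℕ} (hk : 1 ≤ k) : 2 ≤ crit k := by
  have : (1 : ℝ) ≤ k := by exact_mod_cast hk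
  unfold crit
  nlinarith

/-- Interpolation of moments below the critical exponent. -/
lemma rpow_integral_le_of_le {k N : ℕ} {r q l : ℝ} (hr : 1 ≤ r) (hrq : r ≤ q) (hl : 0 < l)
    (h : ∫ x in Set.Icc (0 : Fin k → ℝ) 1, ‖vsum k N x‖ ^ q ≤ l ^ q) :
    (∫ x in Set.Icc (0 : Fin k → ℝ) 1, ‖vsum k N x‖ ^ r) ^ (1 / r) ≤ 2 * l := by
  have hr0 : 0 < r := by linarith
  have hpt : ∀ t : ℝ, 0 ≤ t → t ^ r ≤ l ^ r + l ^ (r - q) * t ^ q := by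
    intro t ht
    rcases le_total t l with htl | htl
    · have h1 := Real.rpow_le_rpow ht htl hr0.le
      have h2 : 0 ≤ l ^ (r - q) * t ^ q := by positivity
      linarith
    · have ht0 : 0 < t := hl.trans_le htl
      have h1 : t ^ r = t ^ (r - q) * t ^ q := by rw [← Real.rpow_add ht0]; ring_nf
      have h2 : t ^ (r - q) ≤ l ^ (r - q) :=
        Real.rpow_le_rpow_of_nonpos hl htl (by linarith)
      have h3 : t ^ (r - q) * t ^ q ≤ l ^ (r - q) * t ^ q := by gcongr
      have h4 : 0 ≤ l ^ r := by positivity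
      linarith
  have hcq := integrableOn_unit (continuous_norm_vsum_rpow k N (hr0.le.trans hrq))
  have h1 : ∫ x in Set.Icc (0 : Fin k → ℝ) 1, ‖vsum k N x‖ ^ r ≤
      ∫ x in Set.Icc (0 : Fin k → ℝ) 1, (l ^ r + l ^ (r - q) * ‖vsum k N x‖ ^ q) :=
    integral_mono (integrableOn_unit (continuous_norm_vsum_rpow k N hr0.le))
      ((integrableOn_unit continuous_const).add (hcq.const_mul _))
      fun x => hpt _ (norm_nonneg _)
  rw [integral_add (integrableOn_unit continuous_const) (hcq.const_mul _),
    setIntegral_unit_const, integral_const_mul] at h1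
  have h2 : l ^ (r - q) * l ^ q = l ^ r := by rw [← Real.rpow_add hl]; ring_nf
  have h3 : l ^ (r - q) * ∫ x in Set.Icc (0 : Fin k → ℝ) 1, ‖vsum k N x‖ ^ q ≤
      l ^ (r - q) * l ^ q := by gcongr
  have h4 : (2 : ℝ) * l ^ r ≤ (2 * l) ^ r := by
    rw [Real.mul_rpow zero_le_two hl.le]
    gcongr
    simpa using Real.rpow_le_rpow_of_exponent_le one_le_two hr
  have h5 : ∫ x in Set.Icc (0 : Fin k → ℝ) 1, ‖vsum k N x‖ ^ r ≤ (2 * l) ^ r := by linarith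
  rw [one_div, Real.rpow_inv_le_iff_of_pos (integral_nonneg fun x => by positivity)
    (by positivity) hr0]
  exact h5

/-- Trivial interpolation of moments above the critical exponent. -/
lemma integral_le_of_ge {k N : ℕ} {r q : ℝ} (hq : 0 ≤ q) (hrq : q ≤ r) :
    ∫ x in Set.Icc (0 : Fin k → ℝ) 1, ‖vsum k N x‖ ^ r ≤
      (N : ℝ) ^ (r - q) * ∫ x in Set.Icc (0 : Fin k → ℝ) 1, ‖vsum k N x‖ ^ q := by
  rw [← integral_const_mul]
  refine integral_mono (integrableOn_unit (continuous_norm_vsum_rpow k N (hq.trans hrq)))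
    ((integrableOn_unit (continuous_norm_vsum_rpow k N hq)).const_mul _) fun x => ?_
  have h1 := norm_vsum_le k N x
  have h2 : ‖vsum k N x‖ ^ r = ‖vsum k N x‖ ^ (r - q) * ‖vsum k N x‖ ^ q := by
    rw [← Real.rpow_add_of_nonneg (norm_nonneg _) (by linarith) hq]
    ring_nf
  simp only [h2]
  gcongr

/-- The mean value theorem for all exponents. -/
lemma rpow_integral_vsum_le {k : ℕ} (hk : 1 ≤ k) {r ε : ℝ} (hr : 1 ≤ r) (hε : 0 < ε) :
    ∃ C : ℝ, ∀ N : ℕ, 1 ≤ N →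
      (∫ x in Set.Icc (0 : Fin k → ℝ) 1, ‖vsum k N x‖ ^ r) ^ (1 / r) ≤
        C * (N : ℝ) ^ ε * ((N : ℝ) ^ ((1 : ℝ) / 2) + (N : ℝ) ^ (1 - crit k / (2 * r))) := by
  obtain ⟨A, hA, h⟩ := exists_integral_crit_le hk hε
  have hq := two_le_crit hk
  have hq0 := crit_pos hk
  have hr0 : 0 < r := by linarith
  have hroot : ∀ {t s : ℝ}, 1 ≤ t → 1 ≤ s → t ^ (1 / s) ≤ t := by
    intro t s ht hs
    have : 1 / s ≤ 1 := by
      rw [div_le_one (by linarith)]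
      exact hs
    simpa using Real.rpow_le_rpow_of_exponent_le ht this
  refine ⟨2 * A, fun N hN => ?_⟩
  have hN1 : (1 : ℝ) ≤ N := by exact_mod_cast hN
  have hN0 : (0 : ℝ) < N := by linarith
  have hB : 1 ≤ A * (N : ℝ) ^ ε :=
    one_le_mul_of_one_le_of_one_le hA (Real.one_le_rpow hN1 hε.le)
  have hN2 : 0 ≤ (N : ℝ) ^ ((1 : ℝ) / 2) := by positivity
  have hN3 : 0 ≤ (N : ℝ) ^ (1 - crit k / (2 * r)) := by positivity
  set B := A * (N : ℝ) ^ ε with hBdef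
  have hB0 : 0 < B := by linarith
  rw [show 2 * A * (N : ℝ) ^ ε = 2 * B by rw [hBdef]; ring]
  rcases le_total r (crit k) with hrq | hrq
  · have h1 := rpow_integral_le_of_le (k := k) (N := N) (q := crit k)
      (l := B ^ (1 / crit k) * (N : ℝ) ^ ((1 : ℝ) / 2)) hr hrq (by positivity) (by
        refine (h N hN).trans_eq ?_
        rw [Real.mul_rpow (by positivity) hN2, ← Real.rpow_mul hB0.le, ← Real.rpow_mul hN0.le,
          one_div_mul_cancel hq0.ne', Real.rpow_one, one_div_mul_eq_div])
    have h2 : B ^ (1 / crit k) ≤ B := hroot hB (by linarith)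
    calc _ ≤ _ := h1
      _ ≤ 2 * (B * (N : ℝ) ^ ((1 : ℝ) / 2)) := by gcongr
      _ ≤ _ := by nlinarith [mul_nonneg hB0.le hN3]
  · have h1 := integral_le_of_ge (k := k) (N := N) hq0.le hrq
    have h2 : ∫ x in Set.Icc (0 : Fin k → ℝ) 1, ‖vsum k N x‖ ^ r ≤
        B * (N : ℝ) ^ (r - crit k / 2) := by
      refine h1.trans ?_
      calc _ ≤ (N : ℝ) ^ (r - crit k) * (B * (N : ℝ) ^ (crit k / 2)) := by
            gcongr
            exact h N hN
        _ = B * ((N : ℝ) ^ (r - crit k) * (N : ℝ) ^ (crit k / 2)) := by ring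
        _ = _ := by
          rw [← Real.rpow_add hN0]
          ring_nf
    have h3 := Real.rpow_le_rpow (z := 1 / r) (integral_nonneg fun x => by positivity) h2
      (by positivity)
    rw [Real.mul_rpow hB0.le (by positivity), ← Real.rpow_mul hN0.le,
      show (r - crit k / 2) * (1 / r) = 1 - crit k / (2 * r) by field_simp] at h3
    have h4 : B ^ (1 / r) ≤ B := hroot hB hr
    calc _ ≤ _ := h3
      _ ≤ B * (N : ℝ) ^ (1 - crit k / (2 * r)) := by gcongr
      _ ≤ _ := by nlinarith [mul_nonneg hB0.le hN3, mul_nonneg hB0.le hN2]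

end

end Vinogradov

/-- Main conjecture in Vinogradov's mean value theorem (Bourgain–Demeter–Guth / Wooley):
for integer `k ≥ 1` and real `p ≥ 1`, for every `ε > 0` there is `C(k,ε)` such that for all
`N ≥ 1`, `‖F_{k,N}‖_{L^p([0,1]^k)} ≤ C(k,ε) N^ε (N^{1/2} + N^{1 - k(k+1)/(2p)})`, where
`F_{k,N}(x) = ∑_{a=1}^N e^{2πi (a x₁ + a² x₂ + … + a^k x_k)}`. -/
theorem vinogradov_mean_value (k : ℕ) (hk : 1 ≤ k) (p : ℝ) (hp : 1 ≤ p) (ε : ℝ) (hε : 0 < ε) :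
    ∃ C : ℝ, ∀ N : ℕ, 1 ≤ N →
      (∫ x in Set.Icc (0 : Fin k → ℝ) 1,
          ‖∑ a ∈ Finset.Icc 1 N,
              Complex.exp (2 * Real.pi * Complex.I *
                ((∑ j : Fin k, (a : ℝ) ^ ((j : ℕ) + 1) * x j : ℝ) : ℂ))‖ ^ p) ^ (1 / p)
        ≤ C * (N : ℝ) ^ ε *
            ((N : ℝ) ^ ((1 : ℝ) / 2) + (N : ℝ) ^ ((1 : ℝ) - (k * (k + 1) : ℝ) / (2 * p))) := by
  have h := Vinogradov.rpow_integral_vsum_le hk hp hε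
  unfold Vinogradov.crit at h
  exact h
end
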